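/- arXiv:0803.1202 — 5 statements merged into one kernel-verified Lean document; each statement's English description precedes it below -/
import Mathlib

section
/- For every k ≥ 0, V((k+1)B) ≤ (1 − η/(2n²)) V(kB). -/
open scoped BigOperators RealInnerProductSpace
open Filter

/-- A square real matrix is doubly stochastic: nonnegative entries,
all row sums and all column sums equal to 1. -/
def IsDoublyStochastic {n : ℕ} (A : Matrix (Fin n) (Fin n) ℝ) : Prop :=
  (∀ i j, 0 ≤ A i j) ∧ (∀ i, ∑ j, A i j = 1) ∧ (∀ j, ∑ i, A i j = 1)

/-- Assumption 1 (Weights): each `A k` is doubly stochastic with positive diagonal,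
and every positive entry is at least `η`, where `η > 0`. -/
def WeightsAssumption {n : ℕ} (A : ℕ → Matrix (Fin n) (Fin n) ℝ) (η : ℝ) : Prop :=
  0 < η ∧ ∀ k, IsDoublyStochastic (A k) ∧ (∀ i, 0 < A k i i) ∧
    (∀ i j, 0 < A k i j → η ≤ A k i j)

/-- Assumption 2 (Connectivity): `B ≥ 1` and, for every `k`, the directed graph with an
edge from `j` to `i` whenever `[A t]_{i j} > 0` for some `t ∈ [kB, (k+1)B)` is strongly
connected (every vertex reaches every other vertex by a directed path). -/
def ConnectivityAssumption {n : ℕ} (A : ℕ → Matrix (Fin n) (Fin n) ℝ) (B : ℕ) : Prop :=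
  1 ≤ B ∧ ∀ k : ℕ, ∀ i j : Fin n,
    Relation.ReflTransGen
      (fun u v : Fin n => ∃ t : ℕ, k * B ≤ t ∧ t < (k + 1) * B ∧ 0 < A t v u) i j

/-- The average of the entries of `z`. -/
noncomputable def zbar {n : ℕ} (z : Fin n → ℝ) : ℝ := (∑ j, z j) / n

/-- The disagreement `V(z) = Σ_j (z_j − z̄)²`. -/
noncomputable def disagreement {n : ℕ} (z : Fin n → ℝ) : ℝ :=
  ∑ j, (z j - zbar z) ^ 2

/-- Applying a doubly stochastic matrix lowers the disagreement by the sum of the variances of the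
entries with respect to the rows. -/
lemma disagreement_sub_disagreement_mulVec {n : ℕ} {A : Matrix (Fin n) (Fin n) ℝ}
    (hA : IsDoublyStochastic A) (z : Fin n → ℝ) :
    disagreement z - disagreement (A.mulVec z) =
      ∑ i, ∑ j, A i j * (z j - A.mulVec z i) ^ 2 := by
  obtain ⟨-, hrow, hcol⟩ := hA
  have hbar : zbar (A.mulVec z) = zbar z := by
    unfold zbar Matrix.mulVec dotProduct
    rw [Finset.sum_comm]
    simp_rw [← Finset.sum_mul, hcol, one_mul]
  have hvar : ∀ i, ∑ j, A i j * (z j - A.mulVec z i) ^ 2 =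
      ∑ j, A i j * (z j - zbar z) ^ 2 - (A.mulVec z i - zbar z) ^ 2 := by
    intro i
    have hmean : ∑ j, A i j * z j = A.mulVec z i := rfl
    calc ∑ j, A i j * (z j - A.mulVec z i) ^ 2
        = ∑ j, (A i j * (z j - zbar z) ^ 2 + 2 * (zbar z - A.mulVec z i) * (A i j * z j)
            + (A.mulVec z i ^ 2 - zbar z ^ 2) * A i j) :=
          Finset.sum_congr rfl fun j _ => by ring
      _ = ∑ j, A i j * (z j - zbar z) ^ 2 + 2 * (zbar z - A.mulVec z i) * A.mulVec z i
            + (A.mulVec z i ^ 2 - zbar z ^ 2) := by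
          rw [Finset.sum_add_distrib, Finset.sum_add_distrib, ← Finset.mul_sum,
            ← Finset.mul_sum, hmean, hrow, mul_one]
      _ = _ := by ring
  simp_rw [hvar]
  rw [Finset.sum_sub_distrib, Finset.sum_comm]
  simp_rw [← Finset.sum_mul, hcol, one_mul]
  rw [disagreement, disagreement, hbar]

/-- The squared gaps of a monotone sequence over a set of positions add up to at most the square of
any length covering the span of these positions. -/
lemma Monotone.sum_sq_sub_le_sq {u : ℕ → ℝ} (hu : Monotone u) {D : Finset ℕ} {m M : ℝ}
    (hmM : m ≤ M) (hm : ∀ d ∈ D, m ≤ u d) (hM : ∀ d ∈ D, u (d + 1) ≤ M) :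
    ∑ d ∈ D, (u (d + 1) - u d) ^ 2 ≤ (M - m) ^ 2 := by
  have hgap : ∀ d, 0 ≤ u (d + 1) - u d := fun d => sub_nonneg.2 (hu d.le_succ)
  have hsum : ∑ d ∈ D, (u (d + 1) - u d) ≤ M - m := by
    rcases D.eq_empty_or_nonempty with rfl | hD
    · simpa using hmM
    · have hle : D.min' hD ≤ D.max' hD + 1 := (D.min'_le_max' hD).trans (Nat.le_succ _)
      calc ∑ d ∈ D, (u (d + 1) - u d)
          ≤ ∑ d ∈ Finset.Ico (D.min' hD) (D.max' hD + 1), (u (d + 1) - u d) := by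
            refine Finset.sum_le_sum_of_subset_of_nonneg (fun d hd => ?_) fun d _ _ => hgap d
            exact Finset.mem_Ico.2 ⟨D.min'_le d hd, Nat.lt_succ_of_le (D.le_max' d hd)⟩
        _ = u (D.max' hD + 1) - u (D.min' hD) := Finset.sum_Ico_sub u hle
        _ ≤ M - m := sub_le_sub (hM _ (D.max'_mem hD)) (hm _ (D.min'_mem hD))
  calc ∑ d ∈ D, (u (d + 1) - u d) ^ 2
      ≤ ∑ d ∈ D, (u (d + 1) - u d) * (M - m) := by
        refine Finset.sum_le_sum fun d hd => ?_
        rw [sq]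
        exact mul_le_mul_of_nonneg_left (sub_le_sub (hM d hd) (hm d hd)) (hgap d)
    _ = (∑ d ∈ D, (u (d + 1) - u d)) * (M - m) := (Finset.sum_mul ..).symm
    _ ≤ (M - m) * (M - m) := mul_le_mul_of_nonneg_right hsum (sub_nonneg.2 hmM)
    _ = (M - m) ^ 2 := (sq _).symm

/-- A weighted sum of squared deviations is at least half the weight of any two of its points times
their squared distance. -/
lemma half_mul_sq_sub_le_sum_mul_sq {ι : Type*} [Fintype ι] {a : ι → ℝ} (ha : ∀ j, 0 ≤ a j)
    {η : ℝ} (x : ι → ℝ) (y : ℝ) {p q : ι} (hp : η ≤ a p) (hq : η ≤ a q) :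
    η / 2 * (x p - x q) ^ 2 ≤ ∑ j, a j * (x j - y) ^ 2 := by
  classical
  have hnonneg : ∀ j, 0 ≤ a j * (x j - y) ^ 2 := fun j => mul_nonneg (ha j) (sq_nonneg _)
  by_cases hpq : p = q
  · subst hpq
    simpa using Finset.sum_nonneg fun j (_ : j ∈ Finset.univ) => hnonneg j
  by_cases hη : η ≤ 0
  · exact (mul_nonpos_of_nonpos_of_nonneg (by linarith) (sq_nonneg _)).trans
      (Finset.sum_nonneg fun j _ => hnonneg j)
  calc η / 2 * (x p - x q) ^ 2
      ≤ η * (x p - y) ^ 2 + η * (x q - y) ^ 2 := by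
        nlinarith [mul_nonneg (not_le.1 hη).le (sq_nonneg (x p - y + (x q - y)))]
    _ ≤ a p * (x p - y) ^ 2 + a q * (x q - y) ^ 2 :=
        add_le_add (mul_le_mul_of_nonneg_right hp (sq_nonneg _))
          (mul_le_mul_of_nonneg_right hq (sq_nonneg _))
    _ = ∑ j ∈ {p, q}, a j * (x j - y) ^ 2 := by rw [Finset.sum_pair hpq]
    _ ≤ ∑ j, a j * (x j - y) ^ 2 :=
        Finset.sum_le_sum_of_subset_of_nonneg (Finset.subset_univ _) fun j _ _ => hnonneg j

/-- `A` has a positive entry linking a vertex of rank at most `d` with one of larger rank. -/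
def CrossesCut {n : ℕ} (p : Fin n → ℕ) (A : Matrix (Fin n) (Fin n) ℝ) (d : ℕ) : Prop :=
  ∃ i j, 0 < A i j ∧ ¬(p i ≤ d ↔ p j ≤ d)

/-- The value `x` separates the vertices of rank at most `d` from the others by the interval
from `u d` to `u (d + 1)`. -/
def SeparatesCut {n : ℕ} (p : Fin n → ℕ) (u : ℕ → ℝ) (x : Fin n → ℝ) (d : ℕ) : Prop :=
  ∀ i, (p i ≤ d → x i ≤ u d) ∧ (¬ p i ≤ d → u (d + 1) ≤ x i)

lemma SeparatesCut.mulVec {n : ℕ} {p : Fin n → ℕ} {u : ℕ → ℝ} {x : Fin n → ℝ} {d : ℕ}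
    (h : SeparatesCut p u x d) {A : Matrix (Fin n) (Fin n) ℝ} (hA : IsDoublyStochastic A)
    (hd : ¬ CrossesCut p A d) : SeparatesCut p u (A.mulVec x) d := by
  obtain ⟨hnonneg, hrow, -⟩ := hA
  have hside : ∀ i j, 0 < A i j → (p i ≤ d ↔ p j ≤ d) := by
    intro i j hij
    by_contra hne
    exact hd ⟨i, j, hij, hne⟩
  refine fun i => ⟨fun hi => ?_, fun hi => ?_⟩
  · calc ∑ j, A i j * x j ≤ ∑ j, A i j * u d := by
          refine Finset.sum_le_sum fun j _ => ?_
          rcases (hnonneg i j).eq_or_lt with h0 | hpos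
          · simp [← h0]
          · exact mul_le_mul_of_nonneg_left ((h j).1 ((hside i j hpos).1 hi)) hpos.le
      _ = u d := by rw [← Finset.sum_mul, hrow, one_mul]
  · calc u (d + 1) = ∑ j, A i j * u (d + 1) := by rw [← Finset.sum_mul, hrow, one_mul]
      _ ≤ ∑ j, A i j * x j := by
          refine Finset.sum_le_sum fun j _ => ?_
          rcases (hnonneg i j).eq_or_lt with h0 | hpos
          · simp [← h0]
          · exact mul_le_mul_of_nonneg_left
              ((h j).2 fun hj => hi ((hside i j hpos).2 hj)) hpos.le

/-- The variance of a row dominates the squared gaps of the separated cuts this row crosses. -/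
lemma sum_sq_gap_le_row_variance {n : ℕ} {p : Fin n → ℕ} {u : ℕ → ℝ} (hu : Monotone u)
    {x : Fin n → ℝ} {a : Fin n → ℝ} (ha : ∀ j, 0 ≤ a j) {η : ℝ} (hη : 0 < η)
    (hpos : ∀ j, 0 < a j → η ≤ a j) {i : Fin n} (hi : 0 < a i) (y : ℝ) {D : Finset ℕ}
    (hsep : ∀ d ∈ D, SeparatesCut p u x d)
    (hcross : ∀ d ∈ D, ∃ j, 0 < a j ∧ ¬(p i ≤ d ↔ p j ≤ d)) :
    η / 2 * ∑ d ∈ D, (u (d + 1) - u d) ^ 2 ≤ ∑ j, a j * (x j - y) ^ 2 := by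
  have hends : ∀ d ∈ D, (∃ j, 0 < a j ∧ x j ≤ u d) ∧ ∃ j, 0 < a j ∧ u (d + 1) ≤ x j := by
    intro d hd
    obtain ⟨j, hj, hij⟩ := hcross d hd
    have hsi := hsep d hd i
    have hsj := hsep d hd j
    by_cases h : p i ≤ d
    · exact ⟨⟨i, hi, hsi.1 h⟩, j, hj, hsj.2 fun h' => hij ⟨fun _ => h', fun _ => h⟩⟩
    · refine ⟨⟨j, hj, hsj.1 ?_⟩, i, hi, hsi.2 h⟩
      by_contra h'
      exact hij ⟨fun h'' => absurd h'' h, fun h'' => absurd h'' h'⟩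
  have hsupp : (Finset.univ.filter fun j => 0 < a j).Nonempty := ⟨i, by simpa using hi⟩
  obtain ⟨jM, hjM, hmax⟩ := Finset.exists_max_image _ x hsupp
  obtain ⟨jm, hjm, hmin⟩ := Finset.exists_min_image _ x hsupp
  simp only [Finset.mem_filter, Finset.mem_univ, true_and] at hjM hjm hmax hmin
  refine le_trans ?_ (half_mul_sq_sub_le_sum_mul_sq ha x y (hpos jM hjM) (hpos jm hjm))
  refine mul_le_mul_of_nonneg_left (hu.sum_sq_sub_le_sq (hmin jM hjM) ?_ ?_) (by positivity)
  · intro d hd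
    obtain ⟨⟨j, hj, hle⟩, -⟩ := hends d hd
    exact (hmin j hj).trans hle
  · intro d hd
    obtain ⟨-, j, hj, hle⟩ := hends d hd
    exact hle.trans (hmax j hj)

/-- One averaging step lowers the disagreement by at least the squared gaps of the separated cuts
it crosses, up to the factor `η / 2`. -/
lemma sum_sq_gap_le_disagreement_sub {n : ℕ} {p : Fin n → ℕ} {u : ℕ → ℝ} (hu : Monotone u)
    {x : Fin n → ℝ} {A : Matrix (Fin n) (Fin n) ℝ} (hA : IsDoublyStochastic A) {η : ℝ}
    (hη : 0 < η) (hdiag : ∀ i, 0 < A i i) (hpos : ∀ i j, 0 < A i j → η ≤ A i j)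
    {D : Finset ℕ} (hsep : ∀ d ∈ D, SeparatesCut p u x d) (hcross : ∀ d ∈ D, CrossesCut p A d) :
    η / 2 * ∑ d ∈ D, (u (d + 1) - u d) ^ 2 ≤ disagreement x - disagreement (A.mulVec x) := by
  classical
  rw [disagreement_sub_disagreement_mulVec hA]
  let R : Fin n → Finset ℕ := fun i => D.filter fun d => ∃ j, 0 < A i j ∧ ¬(p i ≤ d ↔ p j ≤ d)
  calc η / 2 * ∑ d ∈ D, (u (d + 1) - u d) ^ 2
      ≤ η / 2 * ∑ i, ∑ d ∈ R i, (u (d + 1) - u d) ^ 2 := by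
        refine mul_le_mul_of_nonneg_left ?_ (by positivity)
        simp_rw [R, Finset.sum_filter]
        rw [Finset.sum_comm]
        refine Finset.sum_le_sum fun d hd => ?_
        obtain ⟨i, hi⟩ := hcross d hd
        refine (if_pos hi).ge.trans (Finset.single_le_sum (f := fun i =>
          if ∃ j, 0 < A i j ∧ ¬(p i ≤ d ↔ p j ≤ d) then (u (d + 1) - u d) ^ 2 else 0)
          (fun i _ => ?_) (Finset.mem_univ i))
        positivity
    _ = ∑ i, η / 2 * ∑ d ∈ R i, (u (d + 1) - u d) ^ 2 := Finset.mul_sum ..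
    _ ≤ ∑ i, ∑ j, A i j * (x j - A.mulVec x i) ^ 2 := by
        refine Finset.sum_le_sum fun i _ => ?_
        exact sum_sq_gap_le_row_variance hu (hA.1 i) hη (hpos i) (hdiag i) _
          (fun d hd => hsep d (Finset.mem_filter.1 hd).1) fun d hd => (Finset.mem_filter.1 hd).2

/-- The disagreement is at most `n ^ 2` times the sum of the squared gaps of the sorted values. -/
lemma disagreement_le_sq_mul_sum_sq_gap {n : ℕ} (hn : 1 ≤ n) {p : Fin n → ℕ}
    (hp : ∀ i, p i ≤ n - 1) {u : ℕ → ℝ} (hu : Monotone u) {x : Fin n → ℝ}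
    (hx : ∀ i, x i = u (p i)) :
    disagreement x ≤ (n : ℝ) ^ 2 * ∑ d ∈ Finset.range (n - 1), (u (d + 1) - u d) ^ 2 := by
  have hn0 : (0 : ℝ) < n := by exact_mod_cast hn
  have hlo : ∀ i, u 0 ≤ x i := fun i => hx i ▸ hu (Nat.zero_le _)
  have hhi : ∀ i, x i ≤ u (n - 1) := fun i => hx i ▸ hu (hp i)
  have hblo : u 0 ≤ zbar x := by
    rw [zbar, le_div_iff₀ hn0, mul_comm]
    simpa using Finset.card_nsmul_le_sum Finset.univ x (u 0) fun i _ => hlo i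
  have hbhi : zbar x ≤ u (n - 1) := by
    rw [zbar, div_le_iff₀ hn0, mul_comm]
    simpa using Finset.sum_le_card_nsmul Finset.univ x (u (n - 1)) fun i _ => hhi i
  have hspan : (u (n - 1) - u 0) ^ 2 ≤
      n * ∑ d ∈ Finset.range (n - 1), (u (d + 1) - u d) ^ 2 := by
    rw [← Finset.sum_range_sub]
    refine sq_sum_le_card_mul_sum_sq.trans (mul_le_mul_of_nonneg_right ?_ ?_)
    · rw [Finset.card_range]
      exact_mod_cast Nat.sub_le n 1
    · exact Finset.sum_nonneg fun _ _ => sq_nonneg _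
  calc disagreement x ≤ ∑ _j : Fin n, (u (n - 1) - u 0) ^ 2 := by
        refine Finset.sum_le_sum fun j _ => sq_le_sq' ?_ ?_
        · linarith [hlo j]
        · linarith [hhi j]
    _ = n * (u (n - 1) - u 0) ^ 2 := by simp
    _ ≤ n * (n * ∑ d ∈ Finset.range (n - 1), (u (d + 1) - u d) ^ 2) :=
        mul_le_mul_of_nonneg_left hspan hn0.le
    _ = _ := by ring

/-- Every finite real vector factors as a monotone sequence after a ranking of its indices. -/
lemma exists_monotone_rank {n : ℕ} (hn : 1 ≤ n) (x : Fin n → ℝ) :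
    ∃ (p : Fin n → ℕ) (u : ℕ → ℝ), Monotone u ∧ (∀ i, x i = u (p i)) ∧ (∀ i, p i ≤ n - 1) ∧
      ∀ d ≤ n - 1, ∃ i, p i = d := by
  have hlt : ∀ d, min d (n - 1) < n := fun d => by omega
  have hp : ∀ i, ((Tuple.sort x).symm i : ℕ) ≤ n - 1 := fun i => by omega
  refine ⟨fun i => (Tuple.sort x).symm i, fun d => x (Tuple.sort x ⟨min d (n - 1), hlt d⟩),
    fun a b hab => ?_, fun i => ?_, hp, fun d hd => ?_⟩
  · exact Tuple.monotone_sort x (Fin.mk_le_mk.2 (min_le_min_right _ hab))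
  · simp only [min_eq_left (hp i), Fin.eta, Equiv.apply_symm_apply]
  · exact ⟨Tuple.sort x ⟨d, by omega⟩, by simp⟩

/-- A chain of related vertices leaving a set has a step that leaves it. -/
lemma Relation.ReflTransGen.exists_leaving {α : Type*} {r : α → α → Prop} {P : α → Prop} {a b : α}
    (h : Relation.ReflTransGen r a b) (ha : P a) (hb : ¬ P b) : ∃ x y, r x y ∧ P x ∧ ¬ P y := by
  induction h with
  | refl => exact absurd ha hb
  | @tail x y _ hxy ih =>
    by_cases hx : P x
    · exact ⟨x, y, hxy, hx, hb⟩
    · exact ih hx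

/-- under Assumptions 1 and 2,
`V((k+1)B) ≤ (1 − η/(2n²)) V(kB)` for every `k ≥ 0`. -/
theorem disagreement_contraction
    (n : ℕ) (hn : 1 ≤ n) (A : ℕ → Matrix (Fin n) (Fin n) ℝ) (η : ℝ) (B : ℕ)
    (hA : WeightsAssumption A η) (hConn : ConnectivityAssumption A B)
    (z : ℕ → Fin n → ℝ) (hz : ∀ k, z (k + 1) = (A k).mulVec (z k)) :
    ∀ k : ℕ, disagreement (z ((k + 1) * B)) ≤
      (1 - η / (2 * (n : ℝ) ^ 2)) * disagreement (z (k * B)) := by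
  classical
  intro k
  obtain ⟨hη, hA⟩ := hA
  obtain ⟨p, u, hu, hx, hp, hsurj⟩ := exists_monotone_rank hn (z (k * B))
  set s := k * B with hs
  let C : ℕ → Finset ℕ := fun m =>
    (Finset.range (n - 1)).filter fun d => ∃ t < m, CrossesCut p (A (s + t)) d
  have hsep : ∀ m d, (∀ t < m, ¬ CrossesCut p (A (s + t)) d) →
      SeparatesCut p u (z (s + m)) d := by
    intro m d
    induction m with
    | zero =>
      exact fun _ i => ⟨fun h => (hx i).trans_le (hu h),
        fun h => (hu (not_le.1 h)).trans (hx i).ge⟩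
    | succ m ih =>
      intro h
      rw [← add_assoc, hz]
      exact (ih fun t ht => h t (ht.trans m.lt_succ_self)).mulVec (hA _).1 (h m m.lt_succ_self)
  have hdecr : ∀ m, η / 2 * ∑ d ∈ C m, (u (d + 1) - u d) ^ 2 ≤
      disagreement (z s) - disagreement (z (s + m)) := by
    intro m
    induction m with
    | zero => simp [C]
    | succ m ih =>
      have hsub : C m ⊆ C (m + 1) := fun d hd => by
        obtain ⟨hd, t, ht, hc⟩ := Finset.mem_filter.1 hd
        exact Finset.mem_filter.2 ⟨hd, t, ht.trans m.lt_succ_self, hc⟩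
      have hnew : ∀ d ∈ C (m + 1) \ C m,
          SeparatesCut p u (z (s + m)) d ∧ CrossesCut p (A (s + m)) d := by
        intro d hd
        obtain ⟨hd, hd'⟩ := Finset.mem_sdiff.1 hd
        obtain ⟨hdr, t, ht, hc⟩ := Finset.mem_filter.1 hd
        have hno : ∀ t < m, ¬ CrossesCut p (A (s + t)) d := fun t ht hc =>
          hd' (Finset.mem_filter.2 ⟨hdr, t, ht, hc⟩)
        obtain rfl : t = m := by
          by_contra hne
          exact hno t (by omega) hc
        exact ⟨hsep t d hno, hc⟩
      have hstep := sum_sq_gap_le_disagreement_sub hu (hA (s + m)).1 hη (hA (s + m)).2.1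
        (hA (s + m)).2.2 (fun d hd => (hnew d hd).1) fun d hd => (hnew d hd).2
      rw [← hz] at hstep
      rw [← Finset.sum_sdiff hsub, mul_add, ← add_assoc]
      linarith
  have hall : C B = Finset.range (n - 1) := by
    refine Finset.filter_true_of_mem fun d hd => ?_
    have hd := Finset.mem_range.1 hd
    obtain ⟨a, ha⟩ := hsurj 0 (Nat.zero_le _)
    obtain ⟨b, hb⟩ := hsurj (n - 1) le_rfl
    obtain ⟨x, y, ⟨t, ht, ht', hpos⟩, hxd, hyd⟩ :=
      (hConn.2 k a b).exists_leaving (P := fun i => p i ≤ d) (by omega) (by omega)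
    rw [add_mul, one_mul] at ht'
    refine ⟨t - s, by omega, y, x, ?_, fun h => hyd (h.2 hxd)⟩
    rwa [Nat.add_sub_cancel' ht]
  have hB := hdecr B
  rw [hall] at hB
  have hV := disagreement_le_sq_mul_sum_sq_gap hn hp hu hx
  have hn0 : (0 : ℝ) < n := by exact_mod_cast hn
  have hscaled : η / (2 * (n : ℝ) ^ 2) * disagreement (z s) ≤
      η / 2 * ∑ d ∈ Finset.range (n - 1), (u (d + 1) - u d) ^ 2 := by
    refine (mul_le_mul_of_nonneg_left hV (by positivity)).trans_eq ?_
    field_simp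
  rw [show (k + 1) * B = s + B by rw [hs]; ring]
  linarith
end

section
/- For all integers k ≥ s ≥ 0, V(k) ≤ (1 − η/(2n²))^{⌈(k−s+1)/B⌉ − 2} · V(s). -/
open scoped BigOperators RealInnerProductSpace
open Filter

theorem zbar_mulVec {n : ℕ} {M : Matrix (Fin n) (Fin n) ℝ} (hM : IsDoublyStochastic M)
    (x : Fin n → ℝ) : zbar (M.mulVec x) = zbar x := by
  unfold zbar
  congr 1
  simp only [Matrix.mulVec, dotProduct]
  rw [Finset.sum_comm]
  simp [← Finset.sum_mul, hM.2.2]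

theorem disagreement_nonneg {n : ℕ} (x : Fin n → ℝ) : 0 ≤ disagreement x :=
  Finset.sum_nonneg fun _ _ => sq_nonneg _

theorem disagreement_eq {n : ℕ} (x : Fin n → ℝ) :
    disagreement x = ∑ j, x j ^ 2 - n * zbar x ^ 2 := by
  rcases Nat.eq_zero_or_pos n with rfl | hn
  · simp [disagreement]
  have hn' : (n : ℝ) ≠ 0 := by positivity
  have hs : ∑ j, x j = n * zbar x := by unfold zbar; field_simp
  simp only [disagreement, sub_sq, Finset.sum_add_distrib, Finset.sum_sub_distrib,
    ← Finset.sum_mul, ← Finset.mul_sum, hs]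
  simp
  ring

theorem sum_sum_mul_sub_sq {ι : Type*} [Fintype ι] (a x : ι → ℝ) (ha : ∑ j, a j = 1) :
    ∑ j, ∑ k, a j * a k * (x j - x k) ^ 2 =
      2 * ∑ j, a j * x j ^ 2 - 2 * (∑ j, a j * x j) ^ 2 := by
  have h : ∀ j k, a j * a k * (x j - x k) ^ 2 =
      a j * x j ^ 2 * a k - 2 * ((a j * x j) * (a k * x k)) + a j * (a k * x k ^ 2) := by
    intro j k; ring
  simp only [h, Finset.sum_add_distrib, Finset.sum_sub_distrib, ← Finset.mul_sum,
    ← Finset.sum_mul, ha]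
  ring

/-- The drop of the disagreement in one step, as a sum over pairs of entries. -/
theorem disagreement_sub_mulVec {n : ℕ} {M : Matrix (Fin n) (Fin n) ℝ}
    (hM : IsDoublyStochastic M) (x : Fin n → ℝ) :
    2 * (disagreement x - disagreement (M.mulVec x)) =
      ∑ i, ∑ j, ∑ k, M i j * M i k * (x j - x k) ^ 2 := by
  rw [disagreement_eq, disagreement_eq, zbar_mulVec hM]
  simp only [sum_sum_mul_sub_sq _ x (hM.2.1 _), Finset.sum_sub_distrib, ← Finset.mul_sum]
  rw [Finset.sum_comm]
  simp only [← Finset.sum_mul, hM.2.2, one_mul, Matrix.mulVec, dotProduct]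
  ring

theorem disagreement_mulVec_le {n : ℕ} {M : Matrix (Fin n) (Fin n) ℝ}
    (hM : IsDoublyStochastic M) (x : Fin n → ℝ) :
    disagreement (M.mulVec x) ≤ disagreement x := by
  have h := disagreement_sub_mulVec hM x
  have : 0 ≤ ∑ i, ∑ j, ∑ k, M i j * M i k * (x j - x k) ^ 2 :=
    Finset.sum_nonneg fun i _ => Finset.sum_nonneg fun j _ => Finset.sum_nonneg fun k _ =>
      mul_nonneg (mul_nonneg (hM.1 _ _) (hM.1 _ _)) (sq_nonneg _)
  linarith

/-- The matrix `M` has a positive entry linking a vertex satisfying `P` with one that does not. -/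
def Crosses {n : ℕ} (M : Matrix (Fin n) (Fin n) ℝ) (P : Fin n → Prop) : Prop :=
  ∃ i j, 0 < M i j ∧ ¬(P i ↔ P j)

theorem le_sum_separated_of_crosses {n : ℕ} {M : Matrix (Fin n) (Fin n) ℝ} {η : ℝ}
    (hM : IsDoublyStochastic M) (hd : ∀ i, 0 < M i i) (hη : ∀ i j, 0 < M i j → η ≤ M i j)
    {P : Fin n → Prop} [DecidablePred P] (hP : Crosses M P) :
    η ≤ ∑ i, ∑ j, ∑ k, M i j * M i k * (if P j ↔ P k then 0 else 1) := by
  obtain ⟨i, j, hij, hPij⟩ := hP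
  have hrow : η ≤ ∑ j, ∑ k, M i j * M i k * (if P j ↔ P k then 0 else 1) := by
    set p := ∑ j, if P j then M i j else 0 with hp
    set q := ∑ j, if P j then 0 else M i j with hq
    have hpq : p + q = 1 := by
      rw [hp, hq, ← Finset.sum_add_distrib, ← hM.2.1 i]
      exact Finset.sum_congr rfl fun j _ => by split_ifs <;> simp
    have heq : ∑ j, ∑ k, M i j * M i k * (if P j ↔ P k then 0 else 1) = 2 * (p * q) := by
      have : 2 * (p * q) = p * q + q * p := by ring
      rw [this, hp, hq, Finset.sum_mul_sum, Finset.sum_mul_sum, ← Finset.sum_add_distrib]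
      refine Finset.sum_congr rfl fun j _ => ?_
      rw [← Finset.sum_add_distrib]
      refine Finset.sum_congr rfl fun k _ => ?_
      by_cases h1 : P j <;> by_cases h2 : P k <;> simp [h1, h2]
    have hple : ∀ k, P k → 0 < M i k → η ≤ p := fun k hk hpos => by
      refine (hη i k hpos).trans ?_
      have := Finset.single_le_sum (f := fun j => if P j then M i j else 0)
        (fun j _ => ite_nonneg (hM.1 i j) le_rfl) (Finset.mem_univ k)
      simpa [hk] using this
    have hqle : ∀ k, ¬ P k → 0 < M i k → η ≤ q := fun k hk hpos => by
      refine (hη i k hpos).trans ?_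
      have := Finset.single_le_sum (f := fun j => if P j then 0 else M i j)
        (fun j _ => ite_nonneg le_rfl (hM.1 i j)) (Finset.mem_univ k)
      simpa [hk] using this
    have hboth : η ≤ p ∧ η ≤ q := by
      by_cases h1 : P i
      · have h2 : ¬ P j := by tauto
        exact ⟨hple i h1 (hd i), hqle j h2 hij⟩
      · have h2 : P j := by tauto
        exact ⟨hple j h2 hij, hqle i h1 (hd i)⟩
    rw [heq]
    have hq' : q = 1 - p := by linarith
    rcases le_total p (1 / 2) with h | h
    · have hp0 : 0 ≤ p := Finset.sum_nonneg fun j _ => ite_nonneg (hM.1 i j) le_rfl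
      nlinarith [hboth.1]
    · have hq0 : 0 ≤ q := Finset.sum_nonneg fun j _ => ite_nonneg le_rfl (hM.1 i j)
      nlinarith [hboth.2]
  refine hrow.trans (Finset.single_le_sum
    (f := fun i => ∑ j, ∑ k, M i j * M i k * (if P j ↔ P k then (0 : ℝ) else 1))
    (fun i _ => Finset.sum_nonneg fun j _ => Finset.sum_nonneg fun k _ => ?_) (Finset.mem_univ i))
  exact mul_nonneg (mul_nonneg (hM.1 _ _) (hM.1 _ _)) (by split_ifs <;> norm_num)

theorem disagreement_mulVec_add_le {n : ℕ} {M : Matrix (Fin n) (Fin n) ℝ} {η : ℝ}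
    (hM : IsDoublyStochastic M) (hd : ∀ i, 0 < M i i) (hη : ∀ i j, 0 < M i j → η ≤ M i j)
    {ι : Type*} (D : Finset ι) (P : ι → Fin n → Prop) [∀ d, DecidablePred (P d)]
    (w : ι → ℝ) (hw : ∀ d ∈ D, 0 ≤ w d)
    (hcross : ∀ d ∈ D, Crosses M (P d)) (x : Fin n → ℝ)
    (hsep : ∀ j k, ∑ d ∈ D, w d * (if P d j ↔ P d k then 0 else 1) ≤ (x j - x k) ^ 2) :
    disagreement (M.mulVec x) + η / 2 * ∑ d ∈ D, w d ≤ disagreement x := by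
  have h := disagreement_sub_mulVec hM x
  have h1 : ∑ i, ∑ j, ∑ k, M i j * M i k *
        (∑ d ∈ D, w d * (if P d j ↔ P d k then 0 else 1)) ≤
      ∑ i, ∑ j, ∑ k, M i j * M i k * (x j - x k) ^ 2 :=
    Finset.sum_le_sum fun i _ => Finset.sum_le_sum fun j _ => Finset.sum_le_sum fun k _ =>
      mul_le_mul_of_nonneg_left (hsep j k) (mul_nonneg (hM.1 _ _) (hM.1 _ _))
  have h2 : ∑ i, ∑ j, ∑ k, M i j * M i k *
        (∑ d ∈ D, w d * (if P d j ↔ P d k then 0 else 1)) =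
      ∑ d ∈ D, w d * ∑ i, ∑ j, ∑ k, M i j * M i k * (if P d j ↔ P d k then 0 else 1) := by
    simp only [Finset.mul_sum]
    simp only [Finset.sum_comm (t := D)]
    refine Finset.sum_congr rfl fun d _ => Finset.sum_congr rfl fun i _ =>
      Finset.sum_congr rfl fun j _ => Finset.sum_congr rfl fun k _ => ?_
    ring
  have h3 : ∑ d ∈ D, w d * η ≤
      ∑ d ∈ D, w d * ∑ i, ∑ j, ∑ k, M i j * M i k * (if P d j ↔ P d k then 0 else 1) :=
    Finset.sum_le_sum fun d hdD => mul_le_mul_of_nonneg_left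
      (le_sum_separated_of_crosses hM hd hη (hcross d hdD)) (hw d hdD)
  rw [← Finset.sum_mul] at h3
  linarith

/-- Averaging over weights that do not cross `P` preserves bounds holding on `P`. -/
theorem mulVec_le_of_not_crosses {n : ℕ} {M : Matrix (Fin n) (Fin n) ℝ}
    (hM : IsDoublyStochastic M) {P : Fin n → Prop} (hP : ¬ Crosses M P) {x : Fin n → ℝ} {c : ℝ}
    (hx : ∀ j, P j → x j ≤ c) (i : Fin n) (hi : P i) : M.mulVec x i ≤ c := by
  have : ∑ j, M i j * x j ≤ ∑ j, M i j * c := by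
    refine Finset.sum_le_sum fun j _ => ?_
    rcases (hM.1 i j).eq_or_lt with h | h
    · simp [← h]
    · have hj : P j := by
        by_contra hj
        exact hP ⟨i, j, h, by tauto⟩
      exact mul_le_mul_of_nonneg_left (hx j hj) h.le
  rwa [← Finset.sum_mul, hM.2.1, one_mul] at this

theorem le_mulVec_of_not_crosses {n : ℕ} {M : Matrix (Fin n) (Fin n) ℝ}
    (hM : IsDoublyStochastic M) {P : Fin n → Prop} (hP : ¬ Crosses M P) {x : Fin n → ℝ} {c : ℝ}
    (hx : ∀ j, ¬ P j → c ≤ x j) (i : Fin n) (hi : ¬ P i) : c ≤ M.mulVec x i := by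
  have hP' : ¬ Crosses M (fun j => ¬ P j) := fun ⟨i, j, h, h'⟩ => hP ⟨i, j, h, by tauto⟩
  have := mulVec_le_of_not_crosses hM hP' (x := -x) (c := -c)
    (fun j hj => neg_le_neg (hx j hj)) i hi
  rw [Matrix.mulVec_neg, Pi.neg_apply] at this
  linarith

theorem sum_gap_sq_le {g : ℕ → ℝ} (hg : Monotone g) (F : Finset ℕ) {u v : ℝ}
    (hu : ∀ d ∈ F, u ≤ g d) (hv : ∀ d ∈ F, g (d + 1) ≤ v) :
    ∑ d ∈ F, (g (d + 1) - g d) ^ 2 ≤ (v - u) ^ 2 := by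
  rcases F.eq_empty_or_nonempty with rfl | hF
  · simpa using sq_nonneg _
  have hgap : ∀ d, 0 ≤ g (d + 1) - g d := fun d => sub_nonneg.2 (hg d.le_succ)
  have h1 : ∑ d ∈ F, (g (d + 1) - g d) ^ 2 ≤ (∑ d ∈ F, (g (d + 1) - g d)) ^ 2 :=
    Finset.sum_sq_le_sq_sum_of_nonneg fun d _ => hgap d
  refine h1.trans (pow_le_pow_left₀ (Finset.sum_nonneg fun d _ => hgap d) ?_ 2)
  have h2 : ∑ d ∈ F, (g (d + 1) - g d) ≤
      ∑ d ∈ Finset.Ico (F.min' hF) (F.max' hF + 1), (g (d + 1) - g d) :=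
    Finset.sum_le_sum_of_subset_of_nonneg
      (fun d hd => Finset.mem_Ico.2 ⟨F.min'_le d hd, Nat.lt_succ_of_le (F.le_max' d hd)⟩)
      fun d _ _ => hgap d
  rw [Finset.sum_Ico_sub g ((F.min'_le _ (F.max'_mem hF)).trans (Nat.le_succ _))] at h2
  linarith [hu _ (F.min'_mem hF), hv _ (F.max'_mem hF)]

theorem exists_monotone_rank_s2 {n : ℕ} (x : Fin n → ℝ) :
    ∃ (g : ℕ → ℝ) (r : Fin n ≃ Fin n), Monotone g ∧ ∀ j, x j = g (r j) := by
  rcases Nat.eq_zero_or_pos n with rfl | hn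
  · exact ⟨fun _ => 0, Equiv.refl _, monotone_const, fun j => j.elim0⟩
  refine ⟨fun m => x (Tuple.sort x ⟨min m (n - 1), by omega⟩), (Tuple.sort x).symm, ?_, ?_⟩
  · intro a b hab
    exact Tuple.monotone_sort x (Fin.mk_le_mk.2 (min_le_min_right _ hab))
  · intro j
    have : (⟨min ((Tuple.sort x).symm j : ℕ) (n - 1), by omega⟩ : Fin n) =
        (Tuple.sort x).symm j := Fin.ext (min_eq_left (by omega))
    simp only [this, Equiv.apply_symm_apply]

theorem disagreement_le_sum_gap_sq {n : ℕ} (x : Fin n → ℝ) {g : ℕ → ℝ} {r : Fin n → Fin n}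
    (hg : Monotone g) (hx : ∀ j, x j = g (r j)) :
    disagreement x ≤ (n : ℝ) ^ 2 * ∑ d ∈ Finset.range (n - 1), (g (d + 1) - g d) ^ 2 := by
  rcases Nat.eq_zero_or_pos n with rfl | hn
  · simp [disagreement]
  have hn' : (0 : ℝ) < n := by exact_mod_cast hn
  have hlo : ∀ j, g 0 ≤ x j := fun j => hx j ▸ hg (Nat.zero_le _)
  have hhi : ∀ j, x j ≤ g (n - 1) := fun j => hx j ▸ hg (by omega)
  have hzlo : g 0 ≤ zbar x := by
    rw [zbar, le_div_iff₀ hn']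
    have := Finset.sum_le_sum fun j (_ : j ∈ Finset.univ) => hlo j
    simp at this
    linarith
  have hzhi : zbar x ≤ g (n - 1) := by
    rw [zbar, div_le_iff₀ hn']
    have := Finset.sum_le_sum fun j (_ : j ∈ Finset.univ) => hhi j
    simp at this
    linarith
  have hcs : (g (n - 1) - g 0) ^ 2 ≤
      n * ∑ d ∈ Finset.range (n - 1), (g (d + 1) - g d) ^ 2 := by
    rw [← Finset.sum_range_sub]
    refine sq_sum_le_card_mul_sum_sq.trans ?_
    refine mul_le_mul_of_nonneg_right ?_ (Finset.sum_nonneg fun _ _ => sq_nonneg _)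
    rw [Finset.card_range]
    exact_mod_cast Nat.sub_le n 1
  have hj : ∀ j ∈ Finset.univ, (x j - zbar x) ^ 2 ≤
      n * ∑ d ∈ Finset.range (n - 1), (g (d + 1) - g d) ^ 2 := fun j _ => by
    refine le_trans (sq_le_sq' ?_ ?_) hcs <;> linarith [hlo j, hhi j]
  have := Finset.sum_le_sum hj
  simp only [Finset.sum_const, Finset.card_univ, Fintype.card_fin, nsmul_eq_mul] at this
  rw [disagreement]
  linarith

open scoped Classical in
theorem disagreement_add_crossed_gaps_le {n : ℕ} {A : ℕ → Matrix (Fin n) (Fin n) ℝ} {η : ℝ}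
    (hA : WeightsAssumption A η) {z : ℕ → Fin n → ℝ}
    (hz : ∀ k, z (k + 1) = (A k).mulVec (z k)) (s : ℕ) {g : ℕ → ℝ} (hg : Monotone g)
    {r : Fin n → Fin n} (hr : ∀ j, z s j = g (r j)) (m : ℕ) :
    disagreement (z (s + m)) + η / 2 *
        ∑ d ∈ Finset.range (n - 1) with ∃ t < m, Crosses (A (s + t)) (fun j => (r j : ℕ) ≤ d),
          (g (d + 1) - g d) ^ 2 ≤ disagreement (z s) := by
  have hinv : ∀ d m, (∀ t < m, ¬ Crosses (A (s + t)) (fun j => (r j : ℕ) ≤ d)) →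
      (∀ j, (r j : ℕ) ≤ d → z (s + m) j ≤ g d) ∧
        (∀ j, ¬ (r j : ℕ) ≤ d → g (d + 1) ≤ z (s + m) j) := by
    intro d m
    induction m with
    | zero =>
      intro _
      exact ⟨fun j hj => hr j ▸ hg hj, fun j hj => hr j ▸ hg (by omega)⟩
    | succ m ih =>
      intro h
      obtain ⟨h1, h2⟩ := ih fun t ht => h t (by omega)
      rw [← add_assoc, hz]
      exact ⟨mulVec_le_of_not_crosses (hA.2 _).1 (h m m.lt_succ_self) h1,
        le_mulVec_of_not_crosses (hA.2 _).1 (h m m.lt_succ_self) h2⟩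
  induction m with
  | zero => simp
  | succ m ih =>
    obtain ⟨hM, hd, hη⟩ := hA.2 (s + m)
    set C : ℕ → Finset ℕ := fun m => {d ∈ Finset.range (n - 1) |
      ∃ t < m, Crosses (A (s + t)) (fun j => (r j : ℕ) ≤ d)} with hC
    have hsub : C m ⊆ C (m + 1) := by
      intro d hd
      simp only [hC, Finset.mem_filter] at hd ⊢
      obtain ⟨h1, t, ht, h2⟩ := hd
      exact ⟨h1, t, by omega, h2⟩
    have hnew : ∀ d ∈ C (m + 1) \ C m, Crosses (A (s + m)) (fun j => (r j : ℕ) ≤ d) ∧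
        ∀ t < m, ¬ Crosses (A (s + t)) (fun j => (r j : ℕ) ≤ d) := by
      intro d hd
      simp only [hC, Finset.mem_sdiff, Finset.mem_filter, not_and, not_exists] at hd
      obtain ⟨⟨h1, t, ht, h2⟩, h3⟩ := hd
      have h4 := h3 h1
      rcases Nat.lt_succ_iff_lt_or_eq.1 ht with h | rfl
      · exact absurd h2 (h4 t h)
      · exact ⟨h2, h4⟩
    have hle : ∀ j k, r j ≤ r k → ∑ d ∈ C (m + 1) \ C m, (g (d + 1) - g d) ^ 2 *
        (if ((r j : ℕ) ≤ d ↔ (r k : ℕ) ≤ d) then 0 else 1) ≤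
          (z (s + m) j - z (s + m) k) ^ 2 := by
      intro j k hjk
      have hjk' : (r j : ℕ) ≤ r k := hjk
      have := sum_gap_sq_le hg
        {d ∈ C (m + 1) \ C m | ¬ ((r j : ℕ) ≤ d ↔ (r k : ℕ) ≤ d)}
        (u := z (s + m) j) (v := z (s + m) k)
        (fun d hd => (hinv d m (hnew d (Finset.mem_filter.1 hd).1).2).1 j
          (by have := (Finset.mem_filter.1 hd).2; omega))
        (fun d hd => (hinv d m (hnew d (Finset.mem_filter.1 hd).1).2).2 k
          (by have := (Finset.mem_filter.1 hd).2; omega))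
      rw [Finset.sum_filter] at this
      rw [sub_sq_comm]
      refine le_trans (le_of_eq (Finset.sum_congr rfl fun d _ => ?_)) this
      rw [mul_ite, mul_zero, mul_one, ite_not]
    have hstep := disagreement_mulVec_add_le hM hd hη (C (m + 1) \ C m)
      (fun d j => (r j : ℕ) ≤ d) (fun d => (g (d + 1) - g d) ^ 2) (fun d _ => sq_nonneg _)
      (fun d hd => (hnew d hd).1) (z (s + m)) (fun j k => by
        rcases le_total (r j) (r k) with h | h
        · exact hle j k h
        · rw [sub_sq_comm]
          refine le_trans (le_of_eq (Finset.sum_congr rfl fun d _ => ?_)) (hle k j h)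
          exact congrArg _ (if_congr iff_comm rfl rfl))
    rw [← hz] at hstep
    have hsum := Finset.sum_sdiff hsub (f := fun d => (g (d + 1) - g d) ^ 2)
    change _ + η / 2 * ∑ d ∈ C m, _ ≤ _ at ih
    change _ + η / 2 * ∑ d ∈ C (m + 1), _ ≤ _
    rw [← hsum, mul_add, ← add_assoc s m 1]
    linarith

theorem exists_rel_of_reflTransGen {α : Type*} {R : α → α → Prop} {P : α → Prop} {a b : α}
    (h : Relation.ReflTransGen R a b) (ha : P a) (hb : ¬ P b) : ∃ u v, R u v ∧ P u ∧ ¬ P v := by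
  induction h with
  | refl => exact absurd ha hb
  | @tail u v _ huv ih =>
    by_cases hu : P u
    · exact ⟨u, v, huv, hu, hb⟩
    · exact ih hu

theorem disagreement_block_le {n : ℕ} (hn : 1 ≤ n) {A : ℕ → Matrix (Fin n) (Fin n) ℝ} {η : ℝ}
    {B : ℕ} (hA : WeightsAssumption A η) (hConn : ConnectivityAssumption A B)
    {z : ℕ → Fin n → ℝ} (hz : ∀ k, z (k + 1) = (A k).mulVec (z k)) (k : ℕ) :
    disagreement (z ((k + 1) * B)) ≤
      (1 - η / (2 * (n : ℝ) ^ 2)) * disagreement (z (k * B)) := by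
  classical
  obtain ⟨g, r, hg, hr⟩ := exists_monotone_rank_s2 (z (k * B))
  have h1 := disagreement_add_crossed_gaps_le hA hz (k * B) hg hr B
  have hall : ∀ d ∈ Finset.range (n - 1),
      ∃ t < B, Crosses (A (k * B + t)) (fun j => (r j : ℕ) ≤ d) := by
    intro d hd
    have hd' : d < n - 1 := Finset.mem_range.1 hd
    obtain ⟨u, v, ⟨t, ht1, ht2, hpos⟩, hu, hv⟩ := exists_rel_of_reflTransGen
      (P := fun j => (r j : ℕ) ≤ d)
      (hConn.2 k (r.symm ⟨0, by omega⟩) (r.symm ⟨n - 1, by omega⟩)) (by simp)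
      (by simp only [Equiv.apply_symm_apply]; omega)
    rw [add_mul, one_mul] at ht2
    refine ⟨t - k * B, by omega, v, u, ?_, by tauto⟩
    rwa [Nat.add_sub_cancel' ht1]
  rw [Finset.filter_true_of_mem hall] at h1
  have h2 := disagreement_le_sum_gap_sq (z (k * B)) hg hr
  have hn' : (0 : ℝ) < (n : ℝ) ^ 2 := by positivity
  have h3 : η / (2 * (n : ℝ) ^ 2) * disagreement (z (k * B)) ≤
      η / 2 * ∑ d ∈ Finset.range (n - 1), (g (d + 1) - g d) ^ 2 := by
    have hη := hA.1
    refine (mul_le_mul_of_nonneg_left h2 (by positivity)).trans (le_of_eq ?_)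
    field_simp
  rw [add_mul, one_mul]
  linarith

theorem WeightsAssumption.le_one {n : ℕ} (hn : 1 ≤ n) {A : ℕ → Matrix (Fin n) (Fin n) ℝ} {η : ℝ}
    (hA : WeightsAssumption A η) : η ≤ 1 := by
  obtain ⟨hM, hd, hη⟩ := hA.2 0
  let i : Fin n := ⟨0, hn⟩
  rw [← hM.2.1 i]
  exact (hη i i (hd i)).trans
    (Finset.single_le_sum (fun j _ => hM.1 i j) (Finset.mem_univ i))

/-- under Assumptions 1 and 2, for all `k ≥ s ≥ 0`,
`V(k) ≤ (1 − η/(2n²))^(⌈(k−s+1)/B⌉ − 2) V(s)`. -/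
theorem disagreement_geometric_decay
    (n : ℕ) (hn : 1 ≤ n) (A : ℕ → Matrix (Fin n) (Fin n) ℝ) (η : ℝ) (B : ℕ)
    (hA : WeightsAssumption A η) (hConn : ConnectivityAssumption A B)
    (z : ℕ → Fin n → ℝ) (hz : ∀ k, z (k + 1) = (A k).mulVec (z k)) :
    ∀ k s : ℕ, s ≤ k →
      disagreement (z k) ≤
        (1 - η / (2 * (n : ℝ) ^ 2)) ^ (⌈((k : ℝ) - s + 1) / (B : ℝ)⌉ - 2) *
          disagreement (z s) := by
  intro k s hsk
  have hB : 0 < B := hConn.1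
  have hη0 : 0 < η := hA.1
  have hη1 : η ≤ 1 := hA.le_one hn
  have hn1 : (1 : ℝ) ≤ n := by exact_mod_cast hn
  set c := 1 - η / (2 * (n : ℝ) ^ 2) with hc
  have hc0 : 0 < c := by
    rw [hc, sub_pos, div_lt_one (by positivity)]
    nlinarith
  have hc1 : c ≤ 1 := by
    rw [hc]
    linarith [show 0 ≤ η / (2 * (n : ℝ) ^ 2) by positivity]
  have hanti : Antitone fun k => disagreement (z k) := antitone_nat_of_succ_le fun k => by
    rw [hz]
    exact disagreement_mulVec_le (hA.2 k).1 _
  have hblocks : ∀ p m, disagreement (z ((p + m) * B)) ≤ c ^ m * disagreement (z (p * B)) := by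
    intro p m
    induction m with
    | zero => simp
    | succ m ih =>
      refine (disagreement_block_le hn hA hConn hz (p + m)).trans ?_
      rw [pow_succ' c, mul_assoc]
      exact mul_le_mul_of_nonneg_left ih hc0.le
  obtain ⟨q, hq⟩ : ∃ q, q = k / B := ⟨_, rfl⟩
  obtain ⟨p, hp⟩ : ∃ p, p = (s + B - 1) / B := ⟨_, rfl⟩
  have hqk : q * B ≤ k := hq ▸ Nat.div_mul_le_self k B
  have hkq : k < (q + 1) * B := by rw [hq, mul_comm]; exact Nat.lt_mul_div_succ k hB
  have hps : p * B ≤ s + B - 1 := hp ▸ Nat.div_mul_le_self _ B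
  have hsp : s ≤ p * B := by
    have : s + B - 1 < (p + 1) * B := by rw [hp, mul_comm]; exact Nat.lt_mul_div_succ _ hB
    rw [add_mul, one_mul] at this
    omega
  have hmain : disagreement (z k) ≤ c ^ (q - p) * disagreement (z s) := by
    rcases le_total p q with h | h
    · have h1 := hblocks p (q - p)
      rw [Nat.add_sub_cancel' h] at h1
      exact (hanti hqk).trans (h1.trans
        (mul_le_mul_of_nonneg_left (hanti hsp) (pow_nonneg hc0.le _)))
    · rw [Nat.sub_eq_zero_of_le h, pow_zero, one_mul]
      exact hanti hsk
  refine hmain.trans (mul_le_mul_of_nonneg_right ?_ (disagreement_nonneg _))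
  rw [← zpow_natCast]
  refine zpow_le_zpow_right_of_le_one₀ hc0 hc1 ?_
  rw [sub_le_iff_le_add, Int.ceil_le, div_le_iff₀ (by exact_mod_cast hB)]
  have hnat : k + 1 ≤ (q - p + 2) * B + s := by
    have h1 : q * B ≤ (q - p) * B + p * B := by
      rw [← add_mul]
      exact Nat.mul_le_mul_right B (by omega)
    rw [add_mul, one_mul] at hkq
    rw [add_mul]
    omega
  have hreal : (k : ℝ) + 1 ≤ ((q - p : ℕ) + 2) * B + s := by exact_mod_cast hnat
  push_cast
  linarith
end

section
/- For every fixed s ≥ 0 and all indices i, j ∈ {1,…,n}, the transition matrix entries converge to the uniform value: lim_{k→∞} [Φ(k,s)]_{ij} = 1/n. -/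
open scoped BigOperators RealInnerProductSpace
open Filter

/-- The transition matrix `Φ(k,s) = A(k) A(k−1) ⋯ A(s+1) A(s)` (for `k ≥ s`). -/
noncomputable def Phi {n : ℕ} (A : ℕ → Matrix (Fin n) (Fin n) ℝ) (k s : ℕ) :
    Matrix (Fin n) (Fin n) ℝ :=
  ((List.range (k + 1 - s)).map (fun t => A (k - t))).prod

theorem exists_edge_of_reflTransGen {α : Type*} {r : α → α → Prop} {s : Set α} {x y : α}
    (h : Relation.ReflTransGen r x y) (hx : x ∈ s) (hy : y ∉ s) :
    ∃ u ∈ s, ∃ v ∉ s, r u v := by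
  induction h with
  | refl => exact absurd hx hy
  | @tail b c _ hbc ih =>
    by_cases hb : b ∈ s
    · exact ⟨b, hb, c, hy, hbc⟩
    · exact ih hb

/-- The product `A (a + m - 1) * ⋯ * A (a + 1) * A a` of `m` consecutive matrices. -/
noncomputable def windowProd {n : ℕ} (A : ℕ → Matrix (Fin n) (Fin n) ℝ) (a : ℕ) :
    ℕ → Matrix (Fin n) (Fin n) ℝ
  | 0 => 1
  | m + 1 => A (a + m) * windowProd A a m

section windowProd

variable {n : ℕ} {A : ℕ → Matrix (Fin n) (Fin n) ℝ}

theorem windowProd_add (a m l : ℕ) :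
    windowProd A a (m + l) = windowProd A (a + m) l * windowProd A a m := by
  induction l with
  | zero => simp [windowProd]
  | succ l ih => rw [← add_assoc, windowProd, windowProd, ih, Matrix.mul_assoc, add_assoc a m l]

theorem windowProd_eq_prod (s m : ℕ) :
    windowProd A s m = ((List.range m).map (fun t => A (s + m - 1 - t))).prod := by
  induction m with
  | zero => simp [windowProd]
  | succ m ih =>
    rw [windowProd, List.range_succ_eq_map, List.map_cons, List.prod_cons, ih, List.map_map]
    congr 3
    funext t
    simp only [Function.comp_apply]
    congr 1
    omega

theorem Phi_eq_windowProd {k s : ℕ} (h : s ≤ k) : Phi A k s = windowProd A s (k + 1 - s) := by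
  rw [windowProd_eq_prod, Phi, show s + (k + 1 - s) - 1 = k by omega]

theorem windowProd_mem_doublyStochastic (hA : ∀ k, A k ∈ doublyStochastic ℝ (Fin n)) (a m : ℕ) :
    windowProd A a m ∈ doublyStochastic ℝ (Fin n) := by
  induction m with
  | zero => exact one_mem _
  | succ m ih => exact mul_mem (hA _) ih

theorem mul_le_windowProd_succ (hA : ∀ k, A k ∈ doublyStochastic ℝ (Fin n)) (a m : ℕ)
    (i u j : Fin n) :
    A (a + m) i u * windowProd A a m u j ≤ windowProd A a (m + 1) i j := by
  rw [windowProd, Matrix.mul_apply]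
  exact Finset.single_le_sum (f := fun u => A (a + m) i u * windowProd A a m u j)
    (fun u _ => mul_nonneg (nonneg_of_mem_doublyStochastic (hA _))
      (nonneg_of_mem_doublyStochastic (windowProd_mem_doublyStochastic hA a m)))
    (Finset.mem_univ u)

theorem pow_le_windowProd_of_pos {η : ℝ} (hη : 0 ≤ η)
    (hA : ∀ k, A k ∈ doublyStochastic ℝ (Fin n)) (hlow : ∀ k i j, 0 < A k i j → η ≤ A k i j)
    (a m : ℕ) (i j : Fin n) (hpos : 0 < windowProd A a m i j) :
    η ^ m ≤ windowProd A a m i j := by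
  induction m generalizing i with
  | zero =>
    rcases eq_or_ne i j with rfl | h
    · simp [windowProd]
    · simp [windowProd, h] at hpos
  | succ m ih =>
    have hsum := hpos
    rw [windowProd, Matrix.mul_apply] at hsum
    obtain ⟨u, -, hu⟩ := Finset.exists_lt_of_sum_lt
      (f := fun _ : Fin n => (0 : ℝ)) (by simpa using hsum)
    have hAu : 0 < A (a + m) i u :=
      pos_of_mul_pos_left hu
        (nonneg_of_mem_doublyStochastic (windowProd_mem_doublyStochastic hA a m))
    have hPu : 0 < windowProd A a m u j :=
      pos_of_mul_pos_right hu (nonneg_of_mem_doublyStochastic (hA _))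
    calc η ^ (m + 1) = η * η ^ m := pow_succ' η m
      _ ≤ A (a + m) i u * windowProd A a m u j :=
        mul_le_mul (hlow _ _ _ hAu) (ih u hPu) (pow_nonneg hη m) hAu.le
      _ ≤ _ := mul_le_windowProd_succ hA a m i u j

theorem windowProd_pos_mono (hA : ∀ k, A k ∈ doublyStochastic ℝ (Fin n))
    (hdiag : ∀ k i, 0 < A k i i) (a : ℕ) {m l : ℕ} (hml : m ≤ l) (i j : Fin n)
    (hpos : 0 < windowProd A a m i j) : 0 < windowProd A a l i j := by
  induction l, hml using Nat.le_induction with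
  | base => exact hpos
  | succ l _ ih => exact (mul_pos (hdiag _ i) ih).trans_le (mul_le_windowProd_succ hA a l i i j)

/-- Over each connectivity window, the support of a column gains an index until it is full. -/
theorem min_le_card_support_windowProd {B : ℕ} (hA : ∀ k, A k ∈ doublyStochastic ℝ (Fin n))
    (hdiag : ∀ k i, 0 < A k i i) (hConn : ConnectivityAssumption A B) (K q : ℕ) (j : Fin n) :
    min n q ≤ (Finset.univ.filter fun i => 0 < windowProd A (K * B) (q * B) i j).card := by
  induction q with
  | zero => simp
  | succ q ih =>
    set S := Finset.univ.filter fun i => 0 < windowProd A (K * B) (q * B) i j with hS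
    set T := Finset.univ.filter fun i => 0 < windowProd A (K * B) ((q + 1) * B) i j with hT
    have hqB : q * B ≤ (q + 1) * B := Nat.mul_le_mul_right B q.le_succ
    have hST : S ⊆ T := fun i hi => by
      simp only [hS, hT, Finset.mem_filter, Finset.mem_univ, true_and] at hi ⊢
      exact windowProd_pos_mono hA hdiag _ hqB i j hi
    by_cases hfull : S = Finset.univ
    · have : T = Finset.univ := Finset.univ_subset_iff.1 (hfull ▸ hST)
      simp [this]
    obtain ⟨l, hl⟩ : ∃ l, l ∉ S := by
      by_contra! h
      exact hfull (Finset.eq_univ_iff_forall.2 h)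
    have hjS : j ∈ S := by
      simp only [hS, Finset.mem_filter, Finset.mem_univ, true_and]
      exact windowProd_pos_mono hA hdiag _ (Nat.zero_le _) j j (by simp [windowProd])
    obtain ⟨u, hu, v, hv, t, ht₁, ht₂, hvu⟩ := exists_edge_of_reflTransGen (s := (S : Set (Fin n)))
      (hConn.2 (K + q) j l) (by simpa using hjS) (by simpa using hl)
    have hvT : v ∈ T := by
      simp only [Finset.mem_coe, hS, Finset.mem_filter, Finset.mem_univ, true_and] at hu
      simp only [hT, Finset.mem_filter, Finset.mem_univ, true_and]
      obtain ⟨d, rfl⟩ : ∃ d, t = K * B + d :=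
        ⟨t - K * B, by have : K * B ≤ (K + q) * B := Nat.mul_le_mul_right B (by omega)
                       omega⟩
      have hd₁ : q * B ≤ d := by linarith
      have hd₂ : d + 1 ≤ (q + 1) * B := by linarith
      refine windowProd_pos_mono hA hdiag _ hd₂ v j ?_
      exact (mul_pos hvu (windowProd_pos_mono hA hdiag _ hd₁ u j hu)).trans_le
        (mul_le_windowProd_succ hA _ d v u j)
    have hlt : S.card < T.card :=
      Finset.card_lt_card ⟨hST, fun h => hv (by simpa using h hvT)⟩
    omega

theorem pow_le_windowProd {η : ℝ} {B : ℕ} (hη : 0 ≤ η)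
    (hA : ∀ k, A k ∈ doublyStochastic ℝ (Fin n)) (hdiag : ∀ k i, 0 < A k i i)
    (hlow : ∀ k i j, 0 < A k i j → η ≤ A k i j) (hConn : ConnectivityAssumption A B)
    (K : ℕ) (i j : Fin n) : η ^ (n * B) ≤ windowProd A (K * B) (n * B) i j := by
  have hcard := min_le_card_support_windowProd hA hdiag hConn K n j
  rw [min_self] at hcard
  have huniv := (Finset.card_eq_iff_eq_univ _).1
    (le_antisymm (Finset.card_le_univ _) ((Fintype.card_fin n).trans_le hcard))
  exact pow_le_windowProd_of_pos hη hA hlow _ _ i j (Finset.filter_eq_self.1 huniv i (by simp))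

end windowProd

/-- A row-stochastic matrix with entries at least `δ` contracts oscillations by `1 - δ`. -/
theorem mulVec_sub_mulVec_le {ι : Type*} [Fintype ι] {Q : Matrix ι ι ℝ} {δ C : ℝ} {x : ι → ℝ}
    (hQ : ∀ i j, 0 ≤ Q i j) (hrow : ∀ i, ∑ j, Q i j = 1) (hδ : δ ≤ 1) (hQδ : ∀ i j, δ ≤ Q i j)
    (hx : ∀ i j, x i - x j ≤ C) (i j : ι) :
    Q.mulVec x i - Q.mulVec x j ≤ (1 - δ) * C := by
  have : Nonempty ι := ⟨i⟩
  obtain ⟨a, ha⟩ := Finite.exists_max x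
  obtain ⟨b, hb⟩ := Finite.exists_min x
  have hupper : δ * (x a - x b) ≤ x a - Q.mulVec x i := by
    calc δ * (x a - x b) ≤ Q i b * (x a - x b) :=
          mul_le_mul_of_nonneg_right (hQδ i b) (sub_nonneg.2 (ha b))
      _ ≤ ∑ k, Q i k * (x a - x k) :=
          Finset.single_le_sum (f := fun k => Q i k * (x a - x k))
            (fun k _ => mul_nonneg (hQ i k) (sub_nonneg.2 (ha k))) (Finset.mem_univ b)
      _ = x a - Q.mulVec x i := by
          simp only [mul_sub, Finset.sum_sub_distrib, ← Finset.sum_mul, hrow, one_mul,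
            Matrix.mulVec, dotProduct]
  have hlower : x b ≤ Q.mulVec x j := by
    calc x b = ∑ k, Q j k * x b := by rw [← Finset.sum_mul, hrow, one_mul]
      _ ≤ ∑ k, Q j k * x k :=
          Finset.sum_le_sum fun k _ => mul_le_mul_of_nonneg_left (hb k) (hQ j k)
  calc Q.mulVec x i - Q.mulVec x j ≤ (1 - δ) * (x a - x b) := by linarith
    _ ≤ (1 - δ) * C := mul_le_mul_of_nonneg_left (hx a b) (sub_nonneg.2 hδ)

theorem abs_sub_inv_card_le {ι : Type*} [Fintype ι] {x : ι → ℝ} {C : ℝ}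
    (hsum : ∑ i, x i = 1) (hx : ∀ i j, x i - x j ≤ C) (i : ι) :
    |x i - 1 / (Fintype.card ι : ℝ)| ≤ C := by
  have : Nonempty ι := ⟨i⟩
  have hn : (0 : ℝ) < Fintype.card ι := by exact_mod_cast Fintype.card_pos
  have h₁ : ∑ j, (x i - x j) ≤ ∑ _j : ι, C := Finset.sum_le_sum fun j _ => hx i j
  have h₂ : ∑ j, (x j - x i) ≤ ∑ _j : ι, C := Finset.sum_le_sum fun j _ => hx j i
  simp only [Finset.sum_sub_distrib, hsum, Finset.sum_const, Finset.card_univ, nsmul_eq_mul]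
    at h₁ h₂
  have hone : (Fintype.card ι : ℝ) * (1 / Fintype.card ι) = 1 := mul_one_div_cancel hn.ne'
  rw [abs_le]
  constructor <;> refine le_of_mul_le_mul_left ?_ hn <;> rw [mul_sub, hone] <;> linarith

/-- Column oscillations of `windowProd A s` decay geometrically along connectivity windows. -/
theorem windowProd_sub_le {n B : ℕ} {A : ℕ → Matrix (Fin n) (Fin n) ℝ} {η : ℝ} (hη : 0 ≤ η)
    (hη1 : η ≤ 1) (hA : ∀ k, A k ∈ doublyStochastic ℝ (Fin n)) (hdiag : ∀ k i, 0 < A k i i)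
    (hlow : ∀ k i j, 0 < A k i j → η ≤ A k i j) (hConn : ConnectivityAssumption A B)
    (s q r : ℕ) (i i' j : Fin n) :
    windowProd A s (s * B - s + q * (n * B) + r) i j -
      windowProd A s (s * B - s + q * (n * B) + r) i' j ≤ (1 - η ^ (n * B)) ^ q := by
  have hstep (a m l : ℕ) {δ C : ℝ} (hδ : δ ≤ 1)
      (hQ : ∀ i j, δ ≤ windowProd A (a + m) l i j)
      (h : ∀ i i', windowProd A a m i j - windowProd A a m i' j ≤ C) (i i' : Fin n) :
      windowProd A a (m + l) i j - windowProd A a (m + l) i' j ≤ (1 - δ) * C := by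
    have hmem := windowProd_mem_doublyStochastic hA (a + m) l
    rw [windowProd_add]
    exact mulVec_sub_mulVec_le (x := fun u => windowProd A a m u j)
      (fun _ _ => nonneg_of_mem_doublyStochastic hmem)
      (sum_row_of_mem_doublyStochastic hmem) hδ hQ h i i'
  have hmain : ∀ i i', windowProd A s (s * B - s + q * (n * B)) i j -
      windowProd A s (s * B - s + q * (n * B)) i' j ≤ (1 - η ^ (n * B)) ^ q := by
    induction q with
    | zero =>
      intro i i'
      have hmem := windowProd_mem_doublyStochastic hA s (s * B - s + 0 * (n * B))
      have h₁ := le_one_of_mem_doublyStochastic hmem (i := i) (j := j)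
      have h₂ := nonneg_of_mem_doublyStochastic hmem (i := i') (j := j)
      rw [pow_zero]
      linarith
    | succ q ih =>
      have hs : s ≤ s * B := Nat.le_mul_of_pos_right s hConn.1
      have hstart : s + (s * B - s + q * (n * B)) = (s + q * n) * B := by
        rw [← add_assoc, Nat.add_sub_cancel' hs]
        ring
      rw [pow_succ', add_one_mul, ← add_assoc]
      refine hstep s _ _ (pow_le_one₀ hη hη1) (fun i j => ?_) ih
      rw [hstart]
      exact pow_le_windowProd hη hA hdiag hlow hConn _ i j
  simpa using hstep s _ r (δ := 0) zero_le_one (fun _ _ => nonneg_of_mem_doublyStochastic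
    (windowProd_mem_doublyStochastic hA _ _)) hmain i i'

/-- under Assumptions 1 and 2, for every fixed `s` and all indices `i, j`,
the transition matrix entries converge to the uniform value: `[Φ(k,s)]_{ij} → 1/n`. -/
theorem transition_matrix_entry_tendsto
    (n : ℕ) (hn : 1 ≤ n) (A : ℕ → Matrix (Fin n) (Fin n) ℝ) (η : ℝ) (B : ℕ)
    (hA : WeightsAssumption A η) (hConn : ConnectivityAssumption A B) :
    ∀ (s : ℕ) (i j : Fin n),
      Tendsto (fun k : ℕ => Phi A k s i j) atTop (nhds (1 / (n : ℝ))) := by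
  obtain ⟨hη, hA⟩ := hA
  have hmem : ∀ k, A k ∈ doublyStochastic ℝ (Fin n) := fun k =>
    mem_doublyStochastic_iff_sum.2 (hA k).1
  have hdiag : ∀ k i, 0 < A k i i := fun k => (hA k).2.1
  have hlow : ∀ k i j, 0 < A k i j → η ≤ A k i j := fun k => (hA k).2.2
  have hη1 : η ≤ 1 := (hlow 0 ⟨0, hn⟩ ⟨0, hn⟩ (hdiag _ _)).trans
    (le_one_of_mem_doublyStochastic (hmem 0))
  intro s i j
  rw [Metric.tendsto_atTop]
  intro ε hε
  obtain ⟨q, hq⟩ := exists_pow_lt_of_lt_one hε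
    (sub_lt_self 1 (pow_pos hη (n * B)) : 1 - η ^ (n * B) < 1)
  refine ⟨s + (s * B - s + q * (n * B)), fun k hk => ?_⟩
  obtain ⟨r, hr⟩ := Nat.exists_eq_add_of_le
    (show s * B - s + q * (n * B) ≤ k + 1 - s by omega)
  rw [Phi_eq_windowProd (by omega), hr, Real.dist_eq]
  have hcol := sum_col_of_mem_doublyStochastic
    (windowProd_mem_doublyStochastic hmem s (s * B - s + q * (n * B) + r)) j
  have hbound := abs_sub_inv_card_le hcol
    (fun u v => windowProd_sub_le hη.le hη1 hmem hdiag hlow hConn s q r u v j) i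
  rw [Fintype.card_fin] at hbound
  exact hbound.trans_lt hq
end

section
/- For every agent i and every k ≥ 1, the time-averaged iterates x̂_i(k) = (1/k) Σ_{h=0}^{k−1} x_i(h) satisfy f(x̂_i(k)) ≤ f* + n·dist²(y(0), X*)/(2αk) + αL²C/2 + 2αnL²C₁, where C = 1 + 8nC₁, C₁ = 1 + nB/(β(1−β)), β = 1 − η/(4n²), and y(0) = (1/n) Σ_{i=1}^n x_i(0). -/
open scoped BigOperators RealInnerProductSpace
open Filter

/-- `g` is a subgradient of `f` at `x`. -/
def IsSubgradientAt {m : ℕ} (f : EuclideanSpace ℝ (Fin m) → ℝ)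
    (g x : EuclideanSpace ℝ (Fin m)) : Prop :=
  ∀ y, f x + ⟪g, y - x⟫ ≤ f y

/-- Squared gaps of a monotone sequence lying between `v` and `w` sum to at most `(w - v)²`. -/
lemma sum_sq_gap_le {z : ℕ → ℝ} (hz : Monotone z) (D : Finset ℕ) {v w : ℝ} (hvw : v ≤ w)
    (h : ∀ d ∈ D, v ≤ z d ∧ z (d + 1) ≤ w) :
    ∑ d ∈ D, (z (d + 1) - z d) ^ 2 ≤ (w - v) ^ 2 := by
  induction D using Finset.induction_on_max generalizing w with
  | empty => simpa using sq_nonneg (w - v)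
  | insert a s hs ih =>
    rw [Finset.sum_insert fun ha => (hs a ha).false]
    obtain ⟨hva, haw⟩ := h a (Finset.mem_insert_self a s)
    have h1 := ih hva fun d hd =>
      ⟨(h d (Finset.mem_insert_of_mem hd)).1, hz (Nat.succ_le_of_lt (hs d hd))⟩
    have h2 : z a ≤ z (a + 1) := hz (Nat.le_succ a)
    nlinarith [mul_nonneg (sub_nonneg.2 hva) (sub_nonneg.2 h2),
      pow_le_pow_left₀ (sub_nonneg.2 (hva.trans h2)) (sub_le_sub_right haw v) 2]

lemma variance_eq_sum_sq_sub {ι : Type*} [Fintype ι] {p : ι → ℝ} (hp : ∑ j, p j = 1)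
    (x : ι → ℝ) :
    ∑ j, p j * x j ^ 2 - (∑ j, p j * x j) ^ 2 =
      (∑ j, ∑ l, p j * p l * (x j - x l) ^ 2) / 2 := by
  have h : ∀ j l, p j * p l * (x j - x l) ^ 2 =
      p j * x j ^ 2 * p l - 2 * ((p j * x j) * (p l * x l)) + p j * (p l * x l ^ 2) := by
    intros; ring
  simp_rw [h, Finset.sum_add_distrib, Finset.sum_sub_distrib, ← Finset.mul_sum,
    ← Finset.sum_mul, hp]
  ring

/-- The variance of a finitely supported distribution dominates the squared gaps of all the
cuts that split its mass into two parts of mass at least `δ`. -/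
lemma sum_sq_gap_le_variance {ι : Type*} [Fintype ι] {p x : ι → ℝ} {r : ι → ℕ}
    {z : ℕ → ℝ} (hz : Monotone z) (hp0 : ∀ j, 0 ≤ p j) (hp : ∑ j, p j = 1)
    (D : Finset ℕ) {δ : ℝ}
    (hlo : ∀ d ∈ D, ∀ j, r j ≤ d → x j ≤ z d)
    (hhi : ∀ d ∈ D, ∀ j, d < r j → z (d + 1) ≤ x j)
    (hmlo : ∀ d ∈ D, δ ≤ ∑ j, p j * if r j ≤ d then 1 else 0)
    (hmhi : ∀ d ∈ D, δ ≤ ∑ j, p j * if d < r j then 1 else 0) :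
    δ / 2 * ∑ d ∈ D, (z (d + 1) - z d) ^ 2 ≤ ∑ j, p j * x j ^ 2 - (∑ j, p j * x j) ^ 2 := by
  rw [variance_eq_sum_sq_sub hp]
  have key : ∀ j l, r j ≤ r l →
      ∑ d ∈ D, (z (d + 1) - z d) ^ 2 * ((if r j ≤ d then 1 else 0) * (if d < r l then 1 else 0)
        + (if r l ≤ d then 1 else 0) * (if d < r j then 1 else 0)) ≤ (x j - x l) ^ 2 := by
    intro j l hjl
    have h1 : ∀ d ∈ D, (z (d + 1) - z d) ^ 2 * ((if r j ≤ d then 1 else 0) *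
        (if d < r l then 1 else 0) + (if r l ≤ d then 1 else 0) * (if d < r j then 1 else 0)) =
        if r j ≤ d ∧ d < r l then (z (d + 1) - z d) ^ 2 else 0 := by
      intro d _
      split_ifs <;> first | omega | simp
    rw [Finset.sum_congr rfl h1, ← Finset.sum_filter]
    have hb : ∀ d ∈ D.filter (fun d => r j ≤ d ∧ d < r l), x j ≤ z d ∧ z (d + 1) ≤ x l := by
      intro d hd
      rw [Finset.mem_filter] at hd
      exact ⟨hlo d hd.1 j hd.2.1, hhi d hd.1 l hd.2.2⟩
    rcases (D.filter (fun d => r j ≤ d ∧ d < r l)).eq_empty_or_nonempty with he | ⟨d, hd⟩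
    · rw [he, Finset.sum_empty]; positivity
    · have hjl' : x j ≤ x l := (hb d hd).1.trans ((hz d.le_succ).trans (hb d hd).2)
      linarith [sum_sq_gap_le hz _ hjl' hb, sub_sq_comm (x j) (x l)]
  have key' : ∀ j l, ∑ d ∈ D, (z (d + 1) - z d) ^ 2 *
      ((if r j ≤ d then 1 else 0) * (if d < r l then 1 else 0)
        + (if r l ≤ d then 1 else 0) * (if d < r j then 1 else 0)) ≤ (x j - x l) ^ 2 := by
    intro j l
    rcases le_total (r j) (r l) with h | h
    · exact key j l h
    · rw [sub_sq_comm]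
      refine le_trans (le_of_eq (Finset.sum_congr rfl fun d _ => ?_)) (key l j h)
      ring
  have hswap : ∑ j, ∑ l, p j * p l * (∑ d ∈ D, (z (d + 1) - z d) ^ 2 *
      ((if r j ≤ d then 1 else 0) * (if d < r l then 1 else 0)
        + (if r l ≤ d then 1 else 0) * (if d < r j then 1 else 0))) =
      ∑ d ∈ D, (z (d + 1) - z d) ^ 2 * (2 * ((∑ j, p j * if r j ≤ d then 1 else 0) *
        (∑ j, p j * if d < r j then 1 else 0))) := by
    simp_rw [Finset.mul_sum]
    rw [Finset.sum_congr rfl fun j _ => Finset.sum_comm, Finset.sum_comm]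
    refine Finset.sum_congr rfl fun d _ => ?_
    have e : ∀ j l, p j * p l * ((z (d + 1) - z d) ^ 2 *
      ((if r j ≤ d then 1 else 0) * (if d < r l then 1 else 0)
        + (if r l ≤ d then 1 else 0) * (if d < r j then 1 else 0))) =
      (z (d + 1) - z d) ^ 2 * ((p j * if r j ≤ d then 1 else 0) *
        (p l * if d < r l then 1 else 0) + (p j * if d < r j then 1 else 0) *
        (p l * if r l ≤ d then 1 else 0)) := by
      intros; ring
    simp_rw [e, ← Finset.mul_sum, Finset.sum_add_distrib, ← Finset.mul_sum, ← Finset.sum_mul]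
    ring
  have hle : ∑ j, ∑ l, p j * p l * (∑ d ∈ D, (z (d + 1) - z d) ^ 2 *
      ((if r j ≤ d then 1 else 0) * (if d < r l then 1 else 0)
        + (if r l ≤ d then 1 else 0) * (if d < r j then 1 else 0))) ≤
      ∑ j, ∑ l, p j * p l * (x j - x l) ^ 2 :=
    Finset.sum_le_sum fun j _ => Finset.sum_le_sum fun l _ =>
      mul_le_mul_of_nonneg_left (key' j l) (mul_nonneg (hp0 j) (hp0 l))
  rw [hswap] at hle
  have hge : ∑ d ∈ D, (z (d + 1) - z d) ^ 2 * δ ≤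
      ∑ d ∈ D, (z (d + 1) - z d) ^ 2 * (2 * ((∑ j, p j * if r j ≤ d then 1 else 0) *
        (∑ j, p j * if d < r j then 1 else 0))) := by
    refine Finset.sum_le_sum fun d hd => mul_le_mul_of_nonneg_left ?_ (sq_nonneg _)
    have hs : (∑ j, p j * if r j ≤ d then 1 else 0) + (∑ j, p j * if d < r j then 1 else 0)
        = (1 : ℝ) := by
      refine Eq.trans ?_ hp
      rw [← Finset.sum_add_distrib]
      refine Finset.sum_congr rfl fun j _ => ?_
      split_ifs <;> first | omega | simp
    have h1 := hmlo d hd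
    have h2 := hmhi d hd
    have h3 : 0 ≤ ∑ j, p j * if r j ≤ d then (1 : ℝ) else 0 :=
      Finset.sum_nonneg fun j _ => mul_nonneg (hp0 j) (by split_ifs <;> norm_num)
    have h4 : 0 ≤ ∑ j, p j * if d < r j then (1 : ℝ) else 0 :=
      Finset.sum_nonneg fun j _ => mul_nonneg (hp0 j) (by split_ifs <;> norm_num)
    generalize (∑ j, p j * if r j ≤ d then (1 : ℝ) else 0) = P at *
    generalize (∑ j, p j * if d < r j then (1 : ℝ) else 0) = Q at *
    rcases le_total P Q with h | h <;> nlinarith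
  rw [← Finset.sum_mul] at hge
  linarith

/-- One averaging step decreases the sum of squares by a multiple of the squared gaps of the
cuts that are mixed by some row. -/
lemma sum_sq_gap_le_sum_sq_sub {n : ℕ} {A : Matrix (Fin n) (Fin n) ℝ} (hA : IsDoublyStochastic A)
    {x : Fin n → ℝ} {r : Fin n → ℕ} {z : ℕ → ℝ} (hz : Monotone z) (D : Finset ℕ)
    {δ : ℝ}
    (hlo : ∀ d ∈ D, ∀ j, r j ≤ d → x j ≤ z d)
    (hhi : ∀ d ∈ D, ∀ j, d < r j → z (d + 1) ≤ x j)
    (hmix : ∀ d ∈ D, ∃ i, δ ≤ (∑ j, A i j * if r j ≤ d then 1 else 0) ∧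
      δ ≤ ∑ j, A i j * if d < r j then 1 else 0) :
    δ / 2 * ∑ d ∈ D, (z (d + 1) - z d) ^ 2 ≤
      ∑ i, x i ^ 2 - ∑ i, (∑ j, A i j * x j) ^ 2 := by
  classical
  rcases isEmpty_or_nonempty (Fin n) with he | _
  · simp [Finset.eq_empty_of_forall_notMem fun d hd => he.false (hmix d hd).choose]
  choose! row hrow using hmix
  have h1 : ∀ i, δ / 2 * ∑ d ∈ D with row d = i, (z (d + 1) - z d) ^ 2 ≤
      ∑ j, A i j * x j ^ 2 - (∑ j, A i j * x j) ^ 2 := by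
    intro i
    refine sum_sq_gap_le_variance (r := r) hz (hA.1 i) (hA.2.1 i) _ ?_ ?_ ?_ ?_ <;>
      intro d hd <;> rw [Finset.mem_filter] at hd
    · exact hlo d hd.1
    · exact hhi d hd.1
    · rw [← hd.2]; exact (hrow d hd.1).1
    · rw [← hd.2]; exact (hrow d hd.1).2
  have h2 : ∑ i, ∑ d ∈ D with row d = i, (z (d + 1) - z d) ^ 2 =
      ∑ d ∈ D, (z (d + 1) - z d) ^ 2 := Finset.sum_fiberwise _ _ _
  have h3 : ∑ i, ∑ j, A i j * x j ^ 2 = ∑ j, x j ^ 2 := by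
    rw [Finset.sum_comm]
    simp_rw [← Finset.sum_mul, hA.2.2, one_mul]
  rw [← h2, ← h3, Finset.mul_sum, ← Finset.sum_sub_distrib]
  exact Finset.sum_le_sum fun i _ => h1 i

lemma Relation.ReflTransGen.exists_rel_of_not {V : Type*} {R : V → V → Prop} {P : V → Prop}
    {u v : V} (h : Relation.ReflTransGen R u v) (hu : P u) (hv : ¬ P v) :
    ∃ a b, R a b ∧ P a ∧ ¬ P b := by
  induction h with
  | refl => exact absurd hu hv
  | @tail b c _ hbc ih =>
    by_cases hb : P b
    · exact ⟨b, c, hbc, hb, hv⟩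
    · exact ih hb

/-- Over a window whose union graph is strongly connected, averaging contracts the sum of squares
of a zero-sum vector. -/
lemma sum_sq_window_le {n : ℕ} (hn : 1 ≤ n) {A : ℕ → Matrix (Fin n) (Fin n) ℝ} {η : ℝ}
    (hA : WeightsAssumption A η) {B : ℕ}
    (hconn : ∀ i j, Relation.ReflTransGen
      (fun u v : Fin n => ∃ t, t < B ∧ 0 < A t v u) i j)
    {x : ℕ → Fin n → ℝ} (hx : ∀ t i, x (t + 1) i = ∑ j, A t i j * x t j)
    (h0 : ∑ i, x 0 i = 0) :
    ∑ i, x B i ^ 2 ≤ (1 - η / (2 * (n : ℝ) ^ 2)) * ∑ i, x 0 i ^ 2 := by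
  classical
  obtain ⟨hη, hA⟩ := hA
  set σ := Tuple.sort (x 0)
  have hσ : Monotone (x 0 ∘ σ) := Tuple.monotone_sort (x 0)
  set r : Fin n → ℕ := fun i => (σ.symm i : ℕ) with hr
  set z : ℕ → ℝ := fun d => x 0 (σ ⟨min d (n - 1), by omega⟩) with hzdef
  have hz : Monotone z := fun a b hab => hσ (Fin.mk_le_mk.2 (by omega))
  have hzr : ∀ i, z (r i) = x 0 i := by
    intro i
    have : (⟨min (r i) (n - 1), by omega⟩ : Fin n) = σ.symm i := by
      ext
      have := (σ.symm i).2
      simp only [hr]; omega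
    simp only [hzdef, this, Equiv.apply_symm_apply]
  have hrn : ∀ i, r i ≤ n - 1 := fun i => by have := (σ.symm i).2; simp only [hr]; omega
  let Cross : ℕ → ℕ → Prop := fun d t =>
    ∃ i j, 0 < A t i j ∧ (r i ≤ d ∧ d < r j ∨ r j ≤ d ∧ d < r i)
  have hcross : ∀ d ∈ Finset.range (n - 1), ∃ t, t < B ∧ Cross d t ∧ ∀ s < t, ¬ Cross d s := by
    intro d hd
    rw [Finset.mem_range] at hd
    have hex : ∃ t, t < B ∧ Cross d t := by
      obtain ⟨a, b, ⟨t, ht, hab⟩, ha, hb⟩ :=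
        (hconn (σ ⟨0, hn⟩) (σ ⟨n - 1, by omega⟩)).exists_rel_of_not (P := fun i => r i ≤ d)
          (by simp [hr]) (by simp [hr]; omega)
      exact ⟨t, ht, b, a, hab, Or.inr ⟨ha, not_le.1 hb⟩⟩
    obtain ⟨t, htB, ht⟩ := hex
    have hex' : ∃ t, Cross d t := ⟨t, ht⟩
    exact ⟨Nat.find hex', (Nat.find_min' hex' ht).trans_lt htB, Nat.find_spec hex',
      fun s hs => Nat.find_min hex' hs⟩
  choose! T hTB hTc hTmin using hcross
  have hsep : ∀ d t, (∀ s < t, ¬ Cross d s) →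
      (∀ i, r i ≤ d → x t i ≤ z d) ∧ (∀ i, d < r i → z (d + 1) ≤ x t i) := by
    intro d t
    induction t with
    | zero =>
      exact fun _ => ⟨fun i hi => hzr i ▸ hz hi, fun i hi => hzr i ▸ hz hi⟩
    | succ t ih =>
      intro hs
      obtain ⟨ih1, ih2⟩ := ih fun s hst => hs s (by omega)
      have hzero : ∀ i j, (r i ≤ d ∧ d < r j ∨ r j ≤ d ∧ d < r i) → A t i j = 0 :=
        fun i j hij => le_antisymm
          (not_lt.1 fun hpos => hs t t.lt_succ_self ⟨i, j, hpos, hij⟩) ((hA t).1.1 i j)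
      constructor <;> intro i hi <;> rw [hx]
      · calc ∑ j, A t i j * x t j ≤ ∑ j, A t i j * z d := by
              refine Finset.sum_le_sum fun j _ => ?_
              rcases le_or_gt (r j) d with hj | hj
              · exact mul_le_mul_of_nonneg_left (ih1 j hj) ((hA t).1.1 i j)
              · rw [hzero i j (Or.inl ⟨hi, hj⟩)]; simp
          _ = z d := by rw [← Finset.sum_mul, (hA t).1.2.1, one_mul]
      · calc z (d + 1) = ∑ j, A t i j * z (d + 1) := by
              rw [← Finset.sum_mul, (hA t).1.2.1, one_mul]
          _ ≤ ∑ j, A t i j * x t j := by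
              refine Finset.sum_le_sum fun j _ => ?_
              rcases le_or_gt (r j) d with hj | hj
              · rw [hzero i j (Or.inr ⟨hj, hi⟩)]; simp
              · exact mul_le_mul_of_nonneg_left (ih2 j hj) ((hA t).1.1 i j)
  have hstep : ∀ t, η / 2 * ∑ d ∈ Finset.range (n - 1) with T d = t, (z (d + 1) - z d) ^ 2 ≤
      ∑ i, x t i ^ 2 - ∑ i, x (t + 1) i ^ 2 := by
    intro t
    simp_rw [hx]
    refine sum_sq_gap_le_sum_sq_sub (r := r) (hA t).1 hz _ ?_ ?_ ?_ <;> intro d hd <;>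
      rw [Finset.mem_filter] at hd <;> obtain ⟨hd, rfl⟩ := hd
    · exact (hsep d _ (hTmin d hd)).1
    · exact (hsep d _ (hTmin d hd)).2
    · obtain ⟨i, j, hij, hcr⟩ := hTc d hd
      have hmass : ∀ (P : Fin n → Prop) [DecidablePred P] (l : Fin n), P l → 0 < A (T d) i l →
          η ≤ ∑ j, A (T d) i j * if P j then 1 else 0 := by
        intro P _ l hl hpos
        refine ((hA (T d)).2.2 i l hpos).trans ?_
        have := Finset.single_le_sum (f := fun j => A (T d) i j * if P j then (1 : ℝ) else 0)
          (fun j _ => mul_nonneg ((hA (T d)).1.1 i j) (by split_ifs <;> norm_num))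
          (Finset.mem_univ l)
        simpa [hl] using this
      have hii := (hA (T d)).2.1 i
      rcases hcr with ⟨h1, h2⟩ | ⟨h1, h2⟩
      · exact ⟨i, hmass (fun j => r j ≤ d) i h1 hii, hmass (fun j => d < r j) j h2 hij⟩
      · exact ⟨i, hmass (fun j => r j ≤ d) j h1 hij, hmass (fun j => d < r j) i h2 hii⟩
  have htotal : η / 2 * ∑ d ∈ Finset.range (n - 1), (z (d + 1) - z d) ^ 2 ≤
      ∑ i, x 0 i ^ 2 - ∑ i, x B i ^ 2 := by
    rw [← Finset.sum_fiberwise_of_maps_to (t := Finset.range B) (g := T)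
      (fun d hd => Finset.mem_range.2 (hTB d hd)), Finset.mul_sum,
      ← Finset.sum_range_sub' (fun t => ∑ i, x t i ^ 2)]
    exact Finset.sum_le_sum fun t _ => hstep t
  have hcs : (z (n - 1) - z 0) ^ 2 ≤
      (n - 1 : ℕ) * ∑ d ∈ Finset.range (n - 1), (z (d + 1) - z d) ^ 2 := by
    rw [← Finset.sum_range_sub]
    simpa using sq_sum_le_card_mul_sum_sq (s := Finset.range (n - 1))
      (f := fun d => z (d + 1) - z d)
  have hlow : ∀ i, z 0 ≤ x 0 i := fun i => hzr i ▸ hz (Nat.zero_le _)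
  have hhigh : ∀ i, x 0 i ≤ z (n - 1) := fun i => hzr i ▸ hz (hrn i)
  have hn0 : (0 : ℝ) < n := by exact_mod_cast hn
  have hz0 : z 0 ≤ 0 := by
    have : ∑ _i : Fin n, z 0 ≤ ∑ i, x 0 i := Finset.sum_le_sum fun i _ => hlow i
    rw [h0, Finset.sum_const, Finset.card_univ, Fintype.card_fin, nsmul_eq_mul] at this
    nlinarith
  have hzn : 0 ≤ z (n - 1) := by
    have : ∑ i, x 0 i ≤ ∑ _i : Fin n, z (n - 1) := Finset.sum_le_sum fun i _ => hhigh i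
    rw [h0, Finset.sum_const, Finset.card_univ, Fintype.card_fin, nsmul_eq_mul] at this
    nlinarith
  have hV : ∑ i, x 0 i ^ 2 ≤ n * (z (n - 1) - z 0) ^ 2 := by
    have : ∑ i, x 0 i ^ 2 ≤ ∑ _i : Fin n, (z (n - 1) - z 0) ^ 2 :=
      Finset.sum_le_sum fun i _ => by nlinarith [hlow i, hhigh i]
    simpa using this
  set S := ∑ d ∈ Finset.range (n - 1), (z (d + 1) - z d) ^ 2
  have hS : 0 ≤ S := Finset.sum_nonneg fun _ _ => sq_nonneg _
  have hn1 : ((n - 1 : ℕ) : ℝ) ≤ n := by exact_mod_cast Nat.sub_le n 1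
  have hVS : ∑ i, x 0 i ^ 2 ≤ (n : ℝ) ^ 2 * S := by
    nlinarith [mul_le_mul_of_nonneg_right hn1 hS]
  have : η / (2 * (n : ℝ) ^ 2) * ∑ i, x 0 i ^ 2 ≤ η / 2 * S := by
    calc η / (2 * (n : ℝ) ^ 2) * ∑ i, x 0 i ^ 2 ≤ η / (2 * (n : ℝ) ^ 2) * ((n : ℝ) ^ 2 * S) := by
          gcongr
      _ = η / 2 * S := by field_simp
  linarith

/-- Stacked agent states, with the `ℓ²` norm over agents. -/
abbrev AgentStates (n m : ℕ) : Type := PiLp 2 (fun _ : Fin n => EuclideanSpace ℝ (Fin m))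

/-- Every agent replaces its state by the average of all states with weights `A`. -/
noncomputable def mixStates {n m : ℕ} (A : Matrix (Fin n) (Fin n) ℝ) (u : AgentStates n m) :
    AgentStates n m :=
  WithLp.toLp 2 fun i => ∑ j, A i j • u j

/-- `t` successive averaging steps with weights `A 0, …, A (t - 1)`. -/
noncomputable def mixIterate {n m : ℕ} (A : ℕ → Matrix (Fin n) (Fin n) ℝ) (u : AgentStates n m) :
    ℕ → AgentStates n m
  | 0 => u
  | t + 1 => mixStates (A t) (mixIterate A u t)

/-- The deviations of the agent states from their mean. -/
noncomputable def centerStates {n m : ℕ} (u : AgentStates n m) : AgentStates n m :=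
  WithLp.toLp 2 fun i => u i - (1 / (n : ℝ)) • ∑ j, u j

section AgentStates

variable {n m : ℕ}

lemma mixStates_sub (A : Matrix (Fin n) (Fin n) ℝ) (u v : AgentStates n m) :
    mixStates A (u - v) = mixStates A u - mixStates A v := by
  ext i : 1
  simp [mixStates, smul_sub, Finset.sum_sub_distrib]

lemma norm_sq_agentStates (u : AgentStates n m) : ‖u‖ ^ 2 = ∑ c, ∑ i, u i c ^ 2 := by
  rw [PiLp.norm_sq_eq_of_L2, Finset.sum_comm]
  simp_rw [EuclideanSpace.real_norm_sq_eq]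

lemma norm_mixStates_le {A : Matrix (Fin n) (Fin n) ℝ} (hA : IsDoublyStochastic A)
    (u : AgentStates n m) : ‖mixStates A u‖ ≤ ‖u‖ := by
  refine le_of_sq_le_sq ?_ (norm_nonneg _)
  rw [norm_sq_agentStates, norm_sq_agentStates]
  refine Finset.sum_le_sum fun c _ => ?_
  have := sum_sq_gap_le_sum_sq_sub hA (x := fun i => u i c) (r := fun _ => 0)
    (z := fun _ => 0) monotone_const ∅ (δ := 0) (by simp) (by simp) (by simp)
  simpa [mixStates] using this

lemma norm_sq_mixIterate_le (hn : 1 ≤ n) {A : ℕ → Matrix (Fin n) (Fin n) ℝ} {η : ℝ}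
    (hA : WeightsAssumption A η) {B : ℕ}
    (hconn : ∀ i j, Relation.ReflTransGen
      (fun u v : Fin n => ∃ t, t < B ∧ 0 < A t v u) i j)
    {u : AgentStates n m} (h0 : ∑ i, u i = 0) :
    ‖mixIterate A u B‖ ^ 2 ≤ (1 - η / (2 * (n : ℝ) ^ 2)) * ‖u‖ ^ 2 := by
  rw [norm_sq_agentStates, norm_sq_agentStates, Finset.mul_sum]
  refine Finset.sum_le_sum fun c _ => ?_
  refine sum_sq_window_le hn hA hconn (x := fun t i => mixIterate A u t i c) ?_ ?_
  · intro t i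
    simp [mixIterate, mixStates]
  · simpa [mixIterate] using congrArg (fun v => v c) h0

lemma norm_sub_mixIterate_le {A : ℕ → Matrix (Fin n) (Fin n) ℝ}
    (hA : ∀ t, IsDoublyStochastic (A t)) {c : ℝ} {u : ℕ → AgentStates n m}
    (hu : ∀ t, ‖u (t + 1) - mixStates (A t) (u t)‖ ≤ c) (t : ℕ) :
    ‖u t - mixIterate A (u 0) t‖ ≤ t * c := by
  induction t with
  | zero => simp [mixIterate]
  | succ t ih =>
    calc ‖u (t + 1) - mixIterate A (u 0) (t + 1)‖
        = ‖(u (t + 1) - mixStates (A t) (u t)) + mixStates (A t) (u t - mixIterate A (u 0) t)‖ := by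
          rw [mixStates_sub, mixIterate]; congr 1; abel
      _ ≤ c + t * c := norm_add_le_of_le (hu t) ((norm_mixStates_le (hA t) _).trans ih)
      _ = (t + 1 : ℕ) * c := by push_cast; ring

lemma norm_mixIterate_le {A : ℕ → Matrix (Fin n) (Fin n) ℝ}
    (hA : ∀ t, IsDoublyStochastic (A t)) (u : AgentStates n m) (t : ℕ) :
    ‖mixIterate A u t‖ ≤ ‖u‖ := by
  induction t with
  | zero => rfl
  | succ t ih => exact (norm_mixStates_le (hA t) _).trans ih

/-- Zero-mean states that follow the averaging dynamics up to perturbations of norm at most `c`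
stay bounded. -/
lemma norm_perturbed_mix_le (hn : 1 ≤ n) {A : ℕ → Matrix (Fin n) (Fin n) ℝ} {η : ℝ} {B : ℕ}
    (hA : WeightsAssumption A η) (hConn : ConnectivityAssumption A B) {β : ℝ}
    (hβ : β = 1 - η / (4 * (n : ℝ) ^ 2)) (hβ0 : 0 ≤ β) (hβ1 : β < 1)
    {c : ℝ} {u : ℕ → AgentStates n m} (h0 : ∀ t, ∑ i, u t i = 0) (hc : ‖u 0‖ ≤ c)
    (hu : ∀ t, ‖u (t + 1) - mixStates (A t) (u t)‖ ≤ c) (k : ℕ) :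
    ‖u k‖ ≤ c * (B / (1 - β) + B) := by
  obtain ⟨hB, hConn⟩ := hConn
  have hc0 : 0 ≤ c := (norm_nonneg _).trans hc
  have h1β : 0 < 1 - β := sub_pos.2 hβ1
  have hB' : (1 : ℝ) ≤ B := by exact_mod_cast hB
  have hdrift : ∀ q r, ‖u (q * B + r) - mixIterate (fun t => A (q * B + t)) (u (q * B)) r‖
      ≤ r * c := fun q r =>
    norm_sub_mixIterate_le (u := fun t => u (q * B + t)) (fun t => (hA.2 _).1)
      (fun t => hu (q * B + t)) r
  have hcontr : ∀ q, ‖mixIterate (fun t => A (q * B + t)) (u (q * B)) B‖ ≤ β * ‖u (q * B)‖ := by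
    intro q
    refine le_of_sq_le_sq ?_ (by positivity)
    refine (norm_sq_mixIterate_le hn ⟨hA.1, fun t => hA.2 (q * B + t)⟩ ?_ (h0 _)).trans ?_
    · intro i j
      refine (hConn q i j).lift id ?_
      rintro a b ⟨t, ht1, ht2, hpos⟩
      refine ⟨t - q * B, ?_, ?_⟩
      · rw [Nat.succ_mul] at ht2; omega
      · rwa [Nat.add_sub_cancel' ht1]
    · rw [mul_pow]
      refine mul_le_mul_of_nonneg_right ?_ (sq_nonneg _)
      have : η / (2 * (n : ℝ) ^ 2) = 2 * (1 - β) := by rw [hβ]; ring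
      rw [this]
      nlinarith [sq_nonneg (1 - β)]
  have hblock : ∀ q, ‖u (q * B)‖ ≤ c * (B / (1 - β)) := by
    intro q
    induction q with
    | zero =>
      rw [zero_mul]
      refine hc.trans (le_mul_of_one_le_right hc0 ?_)
      rw [le_div_iff₀ h1β]; linarith
    | succ q ih =>
      have h1 := hdrift q B
      have h2 := hcontr q
      have h3 := norm_le_norm_add_norm_sub' (u (q * B + B))
        (mixIterate (fun t => A (q * B + t)) (u (q * B)) B)
      rw [Nat.succ_mul]
      have h4 : β * (c * (B / (1 - β))) + B * c = c * (B / (1 - β)) := by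
        field_simp; ring
      linarith [mul_le_mul_of_nonneg_left ih hβ0]
  have h1 := hdrift (k / B) (k % B)
  have h2 := norm_mixIterate_le (fun t => (hA.2 (k / B * B + t)).1) (u (k / B * B)) (k % B)
  have h3 := norm_le_norm_add_norm_sub' (u (k / B * B + k % B))
        (mixIterate (fun t => A (k / B * B + t)) (u (k / B * B)) (k % B))
  have h4 : ((k % B : ℕ) : ℝ) * c ≤ B * c :=
    mul_le_mul_of_nonneg_right (by exact_mod_cast (Nat.mod_lt k hB).le) hc0
  rw [Nat.div_add_mod'] at h1 h3
  linarith [hblock (k / B)]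

lemma sum_centerStates (hn : 1 ≤ n) (u : AgentStates n m) : ∑ i, centerStates u i = 0 := by
  have : (n : ℝ) ≠ 0 := by positivity
  simp only [centerStates, Finset.sum_sub_distrib, Finset.sum_const, Finset.card_univ,
    Fintype.card_fin]
  rw [← Nat.cast_smul_eq_nsmul ℝ, smul_smul, mul_one_div_cancel this, one_smul, sub_self]

lemma norm_centerStates_le (hn : 1 ≤ n) (u : AgentStates n m) : ‖centerStates u‖ ≤ ‖u‖ := by
  have hn0 : (n : ℝ) ≠ 0 := by positivity
  refine le_of_sq_le_sq ?_ (norm_nonneg _)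
  rw [PiLp.norm_sq_eq_of_L2, PiLp.norm_sq_eq_of_L2]
  simp only [centerStates]
  set a := (1 / (n : ℝ)) • ∑ j, u j with ha
  have hsum : ∑ j, u j = (n : ℝ) • a := by
    rw [ha, smul_smul, mul_one_div_cancel hn0, one_smul]
  have : ∑ i, ‖u i - a‖ ^ 2 = ∑ i, ‖u i‖ ^ 2 - n * ‖a‖ ^ 2 := by
    simp_rw [norm_sub_sq_real, Finset.sum_add_distrib, Finset.sum_sub_distrib, ← Finset.mul_sum,
      ← sum_inner, hsum, real_inner_smul_left, real_inner_self_eq_norm_sq]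
    simp
    ring
  rw [this]
  have : 0 ≤ n * ‖a‖ ^ 2 := by positivity
  linarith

lemma norm_agentStates_le {u : AgentStates n m} {b : ℝ} (hb : 0 ≤ b) (hu : ∀ i, ‖u i‖ ≤ b) :
    ‖u‖ ≤ √n * b := by
  refine le_of_sq_le_sq ?_ (by positivity)
  rw [PiLp.norm_sq_eq_of_L2, mul_pow, Real.sq_sqrt (Nat.cast_nonneg n)]
  have : ∑ i, ‖u i‖ ^ 2 ≤ ∑ _i : Fin n, b ^ 2 :=
    Finset.sum_le_sum fun i _ => pow_le_pow_left₀ (norm_nonneg _) (hu i) 2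
  simpa using this

/-- The distance of the iterates of the distributed subgradient method to their mean. -/
lemma norm_sub_mean_le (hn : 1 ≤ n) {A : ℕ → Matrix (Fin n) (Fin n) ℝ} {η : ℝ} {B : ℕ}
    (hA : WeightsAssumption A η) (hConn : ConnectivityAssumption A B) {β : ℝ}
    (hβ : β = 1 - η / (4 * (n : ℝ) ^ 2)) (hβ0 : 0 ≤ β) (hβ1 : β < 1)
    {α L : ℝ} (hα : 0 ≤ α) (hL : 0 ≤ L) {x d : ℕ → Fin n → EuclideanSpace ℝ (Fin m)}
    (hd : ∀ k i, ‖d k i‖ ≤ L) (hinit : ∀ i, ‖x 0 i‖ ≤ α * L)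
    (hup : ∀ k i, x (k + 1) i = ∑ j, A k i j • x k j - α • d k i) (k : ℕ) (i : Fin n) :
    ‖x k i - (1 / (n : ℝ)) • ∑ j, x k j‖ ≤ √n * (α * L) * (B / (1 - β) + B) := by
  have hαL : 0 ≤ α * L := mul_nonneg hα hL
  have hn0 : (n : ℝ) ≠ 0 := by positivity
  set u : ℕ → AgentStates n m := fun t => centerStates (WithLp.toLp 2 (x t)) with hu
  have hrec : ∀ t, u (t + 1) - mixStates (A t) (u t) =
      centerStates (WithLp.toLp 2 fun i => -(α • d t i)) := by
    intro t
    have hcol : ∑ i, ∑ j, A t i j • x t j = ∑ j, x t j := by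
      rw [Finset.sum_comm]
      simp_rw [← Finset.sum_smul, (hA.2 t).1.2.2, one_smul]
    ext i : 1
    simp only [hu, centerStates, mixStates, hup, PiLp.sub_apply, smul_sub,
      Finset.sum_sub_distrib, hcol, ← Finset.sum_smul, (hA.2 t).1.2.1, one_smul,
      Finset.sum_neg_distrib, smul_neg]
    abel
  have hbound := norm_perturbed_mix_le hn hA hConn hβ hβ0 hβ1 (c := √n * (α * L)) (u := u)
    (fun t => sum_centerStates hn _)
    ((norm_centerStates_le hn _).trans (norm_agentStates_le hαL hinit))
    (fun t => by
      rw [hrec]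
      refine (norm_centerStates_le hn _).trans (norm_agentStates_le hαL fun i => ?_)
      rw [norm_neg, norm_smul, Real.norm_of_nonneg hα]
      exact mul_le_mul_of_nonneg_left (hd t i) hα) k
  exact (PiLp.norm_apply_le (u k) i).trans hbound

end AgentStates

/-- A finite convex function on a Euclidean space has a subgradient at every point. -/
lemma ConvexOn.exists_isSubgradientAt {m : ℕ} {f : EuclideanSpace ℝ (Fin m) → ℝ}
    (hf : ConvexOn ℝ Set.univ f) (x : EuclideanSpace ℝ (Fin m)) :
    ∃ g, IsSubgradientAt f g x := by
  have hcont : Continuous f := continuousOn_univ.1 (hf.continuousOn isOpen_univ)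
  have hopen : IsOpen {p : EuclideanSpace ℝ (Fin m) × ℝ | p.1 ∈ Set.univ ∧ f p.1 < p.2} := by
    simpa using isOpen_lt (hcont.comp continuous_fst) continuous_snd
  obtain ⟨φ, hφ⟩ := geometric_hahn_banach_open_point (x := (x, f x))
    hf.convex_strict_epigraph hopen (by simp)
  set c := φ (0, 1) with hc
  set ψ := φ.comp (ContinuousLinearMap.inl ℝ (EuclideanSpace ℝ (Fin m)) ℝ) with hψ
  have hsplit : ∀ v s, φ (v, s) = ψ v + s * c := by
    intro v s
    have : ((v, s) : EuclideanSpace ℝ (Fin m) × ℝ) = (v, 0) + s • (0, 1) := by simp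
    rw [this, map_add, map_smul]
    simp [hψ, hc]
  have hlt : ∀ v s, f v < s → ψ v + s * c < ψ x + f x * c := by
    intro v s hs
    rw [← hsplit, ← hsplit]
    exact hφ (v, s) ⟨trivial, hs⟩
  have hc0 : c < 0 := by
    have := hlt x (f x + 1) (by linarith)
    linarith
  have hle : ∀ v, ψ v + f v * c ≤ ψ x + f x * c := by
    intro v
    refine le_of_forall_pos_le_add fun ε hε => ?_
    have := hlt v (f v + ε / (-c)) (by linarith [div_pos hε (neg_pos.2 hc0)])
    have h2 : ε / (-c) * c = -ε := by rw [div_neg, neg_mul, div_mul_cancel₀ _ hc0.ne]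
    linarith
  refine ⟨(-c)⁻¹ • (InnerProductSpace.toDual ℝ _).symm ψ, fun v => ?_⟩
  rw [real_inner_smul_left, InnerProductSpace.toDual_symm_apply, map_sub]
  have hc' : 0 < -c := neg_pos.2 hc0
  have : (-c)⁻¹ * (ψ v - ψ x) ≤ f v - f x := by
    rw [inv_mul_le_iff₀ hc']
    linarith [hle v]
  linarith

lemma sub_le_of_forall_subgradient_norm_le {m : ℕ} {f : EuclideanSpace ℝ (Fin m) → ℝ}
    (hf : ConvexOn ℝ Set.univ f) {L : ℝ} (hL : ∀ x g, IsSubgradientAt f g x → ‖g‖ ≤ L)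
    (u v : EuclideanSpace ℝ (Fin m)) : f u - f v ≤ L * ‖u - v‖ := by
  obtain ⟨g, hg⟩ := hf.exists_isSubgradientAt u
  have h1 := hg v
  have h2 := (abs_le.1 (abs_real_inner_le_norm g (v - u))).1
  have h3 := mul_le_mul_of_nonneg_right (hL u g hg) (norm_nonneg (v - u))
  rw [norm_sub_rev u v]
  linarith

/-- Theorem 1: under Assumptions 1 and 2, bounded subgradients
(`‖g‖ ≤ L` for every subgradient of every `f_i`), a nonempty optimal set `X*` of
`f = Σ_i f_i`, and initial points with `max_i ‖x_i(0)‖ ≤ αL`, the time averages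
`x̂_i(k) = (1/k) Σ_{h<k} x_i(h)` of the distributed subgradient iterates satisfy
`f(x̂_i(k)) ≤ f* + n dist²(y(0),X*)/(2αk) + αL²C/2 + 2αnL²C₁`, where
`C = 1 + 8nC₁`, `C₁ = 1 + nB/(β(1−β))`, `β = 1 − η/(4n²)`, and
`y(0) = (1/n) Σ_i x_i(0)`. -/
theorem distributed_subgradient_convergence_rate
    (n m : ℕ) (hn : 1 ≤ n) (hm : 1 ≤ m)
    (A : ℕ → Matrix (Fin n) (Fin n) ℝ) (η : ℝ) (B : ℕ)
    (hA : WeightsAssumption A η) (hConn : ConnectivityAssumption A B)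
    (f : Fin n → EuclideanSpace ℝ (Fin m) → ℝ)
    (hf : ∀ i, ConvexOn ℝ Set.univ (f i))
    (F : EuclideanSpace ℝ (Fin m) → ℝ) (hF : ∀ x, F x = ∑ i, f i x)
    (hXne : {x : EuclideanSpace ℝ (Fin m) | ∀ z, F x ≤ F z}.Nonempty)
    (L : ℝ) (hL : 0 < L)
    (hLb : ∀ (i : Fin n) (x g : EuclideanSpace ℝ (Fin m)),
      IsSubgradientAt (f i) g x → ‖g‖ ≤ L)
    (α : ℝ) (hα : 0 < α)
    (x d : ℕ → Fin n → EuclideanSpace ℝ (Fin m))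
    (hd : ∀ k i, IsSubgradientAt (f i) (d k i) (x k i))
    (hinit : ∀ i, ‖x 0 i‖ ≤ α * L)
    (hup : ∀ k i, x (k + 1) i = ∑ j, A k i j • x k j - α • d k i)
    (β C₁ C : ℝ)
    (hβ : β = 1 - η / (4 * (n : ℝ) ^ 2))
    (hC₁ : C₁ = 1 + (n : ℝ) * B / (β * (1 - β)))
    (hC : C = 1 + 8 * (n : ℝ) * C₁) :
    ∀ (i : Fin n) (k : ℕ), 1 ≤ k →
      F ((1 / (k : ℝ)) • ∑ h ∈ Finset.range k, x h i) ≤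
        sInf (Set.range F)
          + (n : ℝ) *
              Metric.infDist ((1 / (n : ℝ)) • ∑ i, x 0 i)
                {x : EuclideanSpace ℝ (Fin m) | ∀ z, F x ≤ F z} ^ 2 / (2 * α * k)
          + α * L ^ 2 * C / 2 + 2 * α * (n : ℝ) * L ^ 2 * C₁ := by
  have hη : 0 < η := hA.1
  have hn1 : (1 : ℝ) ≤ n := by exact_mod_cast hn
  have hn0 : (0 : ℝ) < n := by linarith
  have hη1 : η ≤ 1 := by
    let i₀ : Fin n := ⟨0, hn⟩
    have h1 := (hA.2 0).2.2 i₀ i₀ ((hA.2 0).2.1 i₀)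
    have h2 := Finset.single_le_sum (f := fun j => A 0 i₀ j) (fun j _ => (hA.2 0).1.1 i₀ j)
      (Finset.mem_univ i₀)
    rw [(hA.2 0).1.2.1] at h2
    exact h1.trans h2
  have hβ1 : β < 1 := by
    have : 0 < η / (4 * (n : ℝ) ^ 2) := by positivity
    linarith
  have hβ0 : 0 < β := by
    have : η / (4 * (n : ℝ) ^ 2) < 1 := by
      rw [div_lt_one (by positivity)]; nlinarith
    linarith
  have h1β : 0 < 1 - β := sub_pos.2 hβ1
  have hB : (1 : ℝ) ≤ B := by exact_mod_cast hConn.1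
  have hdL : ∀ k i, ‖d k i‖ ≤ L := fun k i => hLb i _ _ (hd k i)
  have hLip : ∀ i u v, f i u - f i v ≤ L * ‖u - v‖ := fun i =>
    sub_le_of_forall_subgradient_norm_le (hf i) (hLb i)
  set D : ℝ := 2 * α * L * (C₁ - 1) with hD
  set y : ℕ → EuclideanSpace ℝ (Fin m) := fun k => (1 / (n : ℝ)) • ∑ j, x k j with hy
  have hdev : ∀ k i, ‖x k i - y k‖ ≤ D := by
    intro k i
    refine (norm_sub_mean_le hn hA hConn hβ hβ0.le hβ1 hα.le hL.le hdL hinit hup k i).trans ?_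
    have hsqrt : √(n : ℝ) ≤ n := by
      rw [Real.sqrt_le_left hn0.le]; nlinarith
    have hle : (B : ℝ) / (1 - β) + B ≤ 2 * (B / (β * (1 - β))) := by
      have h1 : (B : ℝ) ≤ B / (1 - β) := by
        rw [le_div_iff₀ h1β]; nlinarith
      have h2 : (B : ℝ) / (1 - β) ≤ B / (β * (1 - β)) := by
        gcongr
        nlinarith
      linarith
    calc √n * (α * L) * (B / (1 - β) + B) ≤ n * (α * L) * (2 * (B / (β * (1 - β)))) := by
          gcongr
      _ = D := by rw [hD, hC₁]; ring
  have hy_succ : ∀ k, y (k + 1) = y k - (α / n) • ∑ j, d k j := by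
    intro k
    have hcol : ∑ i, ∑ j, A k i j • x k j = ∑ j, x k j := by
      rw [Finset.sum_comm]
      simp_rw [← Finset.sum_smul, (hA.2 k).1.2.2, one_smul]
    simp only [hy, hup, Finset.sum_sub_distrib, hcol, smul_sub, ← Finset.smul_sum, smul_smul]
    congr 2
    ring
  have hFconv : ConvexOn ℝ Set.univ F := by
    have : F = ∑ i, f i := by ext z; simp [hF]
    rw [this]
    exact Finset.sum_induction _ (ConvexOn ℝ Set.univ) (fun _ _ ha hb => ha.add hb)
      (convexOn_const 0 convex_univ) fun i _ => hf i
  have hFcont : Continuous F :=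
    continuousOn_univ.1 (hFconv.continuousOn isOpen_univ)
  have hXclosed : IsClosed {x : EuclideanSpace ℝ (Fin m) | ∀ z, F x ≤ F z} := by
    simp only [Set.ofPred_forall]
    exact isClosed_iInter fun z => isClosed_le hFcont continuous_const
  intro i k hk
  obtain ⟨p, hpX, hp⟩ := hXclosed.exists_infDist_eq_dist hXne (y 0)
  have hmin : sInf (Set.range F) = F p :=
    IsLeast.csInf_eq ⟨⟨p, rfl⟩, by rintro _ ⟨z, rfl⟩; exact hpX z⟩
  rw [hmin]
  have hp' : Metric.infDist ((1 / (n : ℝ)) • ∑ i, x 0 i)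
      {x : EuclideanSpace ℝ (Fin m) | ∀ z, F x ≤ F z} = ‖y 0 - p‖ := by
    rw [← dist_eq_norm]; exact hp
  rw [hp']
  have hstep : ∀ h, F (x h i) - F p ≤
      n / (2 * α) * (‖y h - p‖ ^ 2 - ‖y (h + 1) - p‖ ^ 2)
        + (α * n * L ^ 2 / 2 + 3 * n * L * D) := by
    intro h
    have h1 : ∀ j, f j (x h i) - f j p ≤ ⟪d h j, y h - p⟫ + 3 * L * D := by
      intro j
      have a1 := hLip j (x h i) (x h j)
      have a2 : ‖x h i - x h j‖ ≤ D + D := by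
        have := norm_sub_le_norm_sub_add_norm_sub (x h i) (y h) (x h j)
        rw [norm_sub_rev (y h)] at this
        linarith [hdev h i, hdev h j]
      have a3 := hd h j p
      have a4 : ⟪d h j, y h - p⟫ = ⟪d h j, y h - x h j⟫ - ⟪d h j, p - x h j⟫ := by
        rw [← inner_sub_right]; congr 1; abel
      have a5 : -(L * D) ≤ ⟪d h j, y h - x h j⟫ := by
        have b1 := (abs_le.1 (abs_real_inner_le_norm (d h j) (y h - x h j))).1
        have b2 : ‖d h j‖ * ‖y h - x h j‖ ≤ L * D := by
          rw [norm_sub_rev]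
          exact mul_le_mul (hdL h j) (hdev h j) (norm_nonneg _) hL.le
        linarith
      have a6 := mul_le_mul_of_nonneg_left a2 hL.le
      linarith
    have h2 : F (x h i) - F p ≤ ⟪∑ j, d h j, y h - p⟫ + n * (3 * L * D) := by
      rw [hF, hF, ← Finset.sum_sub_distrib, sum_inner]
      refine (Finset.sum_le_sum fun j _ => h1 j).trans ?_
      simp [Finset.sum_add_distrib]
    have h3 : ‖∑ j, d h j‖ ≤ n * L := by
      refine (norm_sum_le _ _).trans ((Finset.sum_le_sum fun j _ => hdL h j).trans ?_)
      simp
    have h4 : ‖y (h + 1) - p‖ ^ 2 = ‖y h - p‖ ^ 2 - 2 * (α / n) * ⟪∑ j, d h j, y h - p⟫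
        + (α / n) ^ 2 * ‖∑ j, d h j‖ ^ 2 := by
      rw [hy_succ, sub_right_comm, norm_sub_sq_real, real_inner_smul_right, norm_smul,
        Real.norm_of_nonneg (by positivity), real_inner_comm]
      ring
    have h5 : ⟪∑ j, d h j, y h - p⟫ = n / (2 * α) * (‖y h - p‖ ^ 2 - ‖y (h + 1) - p‖ ^ 2)
        + α / (2 * n) * ‖∑ j, d h j‖ ^ 2 := by
      rw [h4]; field_simp; ring
    have h6 : α / (2 * n) * ‖∑ j, d h j‖ ^ 2 ≤ α * n * L ^ 2 / 2 := by
      calc α / (2 * n) * ‖∑ j, d h j‖ ^ 2 ≤ α / (2 * n) * (n * L) ^ 2 := by gcongr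
        _ = α * n * L ^ 2 / 2 := by field_simp
    linarith
  have hk0 : (0 : ℝ) < k := by exact_mod_cast hk
  have hjensen : F ((1 / (k : ℝ)) • ∑ h ∈ Finset.range k, x h i) ≤
      1 / k * ∑ h ∈ Finset.range k, F (x h i) := by
    rw [Finset.smul_sum, Finset.mul_sum]
    refine hFconv.map_sum_le (fun _ _ => by positivity) ?_ fun _ _ => Set.mem_univ _
    simp [hk0.ne']
  have hsum : ∑ h ∈ Finset.range k, F (x h i) ≤
      k * F p + (n / (2 * α) * ‖y 0 - p‖ ^ 2 + k * (α * n * L ^ 2 / 2 + 3 * n * L * D)) := by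
    have h1 := Finset.sum_le_sum fun h (_ : h ∈ Finset.range k) => hstep h
    rw [Finset.sum_sub_distrib, Finset.sum_add_distrib, ← Finset.mul_sum,
      Finset.sum_range_sub'] at h1
    simp only [Finset.sum_const, Finset.card_range, nsmul_eq_mul] at h1
    have h2 : 0 ≤ n / (2 * α) * ‖y k - p‖ ^ 2 := by positivity
    linarith
  calc F ((1 / (k : ℝ)) • ∑ h ∈ Finset.range k, x h i)
      ≤ 1 / k * (k * F p + (n / (2 * α) * ‖y 0 - p‖ ^ 2
          + k * (α * n * L ^ 2 / 2 + 3 * n * L * D))) :=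
        hjensen.trans (mul_le_mul_of_nonneg_left hsum (by positivity))
    _ = F p + n * ‖y 0 - p‖ ^ 2 / (2 * α * k) + (α * n * L ^ 2 / 2 + 3 * n * L * D) := by
        field_simp; ring
    _ ≤ F p + n * ‖y 0 - p‖ ^ 2 / (2 * α * k) + α * L ^ 2 * C / 2
          + 2 * α * n * L ^ 2 * C₁ := by
        have : 0 ≤ α * n * L ^ 2 := by positivity
        have : 0 ≤ α * L ^ 2 := by positivity
        rw [hD, hC]
        linarith
end

section
/- For every fixed stopping time k̃ ≥ 0 and every agent i, the stopped-model sequence x̃_i(k) defined for k ≥ k̃ + 1 by x̃_i(k) = Σ_{j=1}^n [Φ(k,0)]_{ij} x_jQ(0) − α Σ_{s=1}^{k̃} Σ_{j=1}^n [Φ(k,s)]_{ij} d̃_j(s−1) − Σ_{s=1}^{k̃} Σ_{j=1}^n [Φ(k,s)]_{ij} e_j(s) converges as k → ∞, and its limit is independent of i and equals y(k̃) = (1/n) Σ_{j=1}^n x_jQ(0) − (α/n) Σ_{s=1}^{k̃} Σ_{j=1}^n d̃_j(s−1) − (1/n) Σ_{s=1}^{k̃} Σ_{j=1}^n e_j(s).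 -/
open scoped BigOperators RealInnerProductSpace
open Filter

/-- A doubly stochastic matrix dissipates the sum of squares by an explicit weighted variance. -/
theorem IsDoublyStochastic.sum_sq_mulVec_add {n : ℕ} {A : Matrix (Fin n) (Fin n) ℝ}
    (hA : IsDoublyStochastic A) (x : Fin n → ℝ) :
    ∑ i, (A.mulVec x) i ^ 2 + ∑ i, ∑ l, A i l * (x l - (A.mulVec x) i) ^ 2 = ∑ l, x l ^ 2 := by
  have hrow : ∀ i, ∑ l, A i l * (x l - (A.mulVec x) i) ^ 2
      = ∑ l, A i l * x l ^ 2 - (A.mulVec x) i ^ 2 := by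
    intro i
    have hy : ∑ l, A i l * x l = (A.mulVec x) i := rfl
    calc ∑ l, A i l * (x l - (A.mulVec x) i) ^ 2
        = ∑ l, (A i l * x l ^ 2 - 2 * (A.mulVec x) i * (A i l * x l)
            + (A.mulVec x) i ^ 2 * A i l) := Finset.sum_congr rfl fun l _ => by ring
      _ = ∑ l, A i l * x l ^ 2 - (A.mulVec x) i ^ 2 := by
          rw [Finset.sum_add_distrib, Finset.sum_sub_distrib, ← Finset.mul_sum, ← Finset.mul_sum,
            hy, hA.2.1 i]
          ring
  have hcol : ∑ i, ∑ l, A i l * x l ^ 2 = ∑ l, x l ^ 2 := by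
    rw [Finset.sum_comm]
    exact Finset.sum_congr rfl fun l _ => by rw [← Finset.sum_mul, hA.2.2 l, one_mul]
  rw [Finset.sum_congr rfl fun i _ => hrow i, Finset.sum_sub_distrib, hcol]
  ring

theorem IsDoublyStochastic.sum_mulVec {n : ℕ} {A : Matrix (Fin n) (Fin n) ℝ}
    (hA : IsDoublyStochastic A) (x : Fin n → ℝ) : ∑ i, (A.mulVec x) i = ∑ l, x l := by
  change ∑ i, ∑ l, A i l * x l = ∑ l, x l
  rw [Finset.sum_comm]
  exact Finset.sum_congr rfl fun l _ => by rw [← Finset.sum_mul, hA.2.2 l, one_mul]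

/-- On a finite type, oscillation along paths of any relation is controlled, uniformly in the
relation, by the oscillation along its edges. -/
theorem exists_abs_sub_le_of_reflTransGen (ι : Type*) [Finite ι] :
    ∃ L : ℕ, ∀ (r : ι → ι → Prop) (i j : ι), Relation.ReflTransGen r i j →
      ∀ (x : ι → ℝ) (ε : ℝ), 0 ≤ ε → (∀ u v, r u v → |x u - x v| ≤ ε) → |x i - x j| ≤ L * ε := by
  have key : ∀ p : (ι → ι → Prop) × ι × ι, ∃ L : ℕ, Relation.ReflTransGen p.1 p.2.1 p.2.2 →
      ∀ (x : ι → ℝ) (ε : ℝ), 0 ≤ ε → (∀ u v, p.1 u v → |x u - x v| ≤ ε) →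
        |x p.2.1 - x p.2.2| ≤ L * ε := by
    rintro ⟨r, i, j⟩
    by_cases h : Relation.ReflTransGen r i j
    · induction h with
      | refl => exact ⟨0, fun _ x ε _ _ => by simp⟩
      | tail hib hbc ih =>
        obtain ⟨L, hL⟩ := ih
        refine ⟨L + 1, fun _ x ε hε hx => ?_⟩
        have h₁ := hL hib x ε hε hx
        have h₂ := hx _ _ hbc
        push_cast
        exact (abs_sub_le _ _ _).trans (by simp only at h₁; linarith)
    · exact ⟨0, fun h' => absurd h' h⟩
  choose L hL using key
  obtain ⟨M, hM⟩ := Finite.exists_le L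
  refine ⟨M, fun r i j hij x ε hε hx => (hL (r, i, j) hij x ε hε hx).trans ?_⟩
  have : (L (r, i, j) : ℝ) ≤ M := by exact_mod_cast hM _
  gcongr

section Consensus

variable {n : ℕ} {A : ℕ → Matrix (Fin n) (Fin n) ℝ} {η : ℝ} {B T : ℕ} {x : ℕ → Fin n → ℝ}

/-- Along active edges, the values of the averaging iteration become asymptotically equal. -/
theorem WeightsAssumption.eventually_abs_sub_le (hA : WeightsAssumption A η)
    (hx : ∀ t ≥ T, x (t + 1) = (A t).mulVec (x t)) {ε : ℝ} (hε : 0 < ε) :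
    ∃ N ≥ T, ∀ t ≥ N, ∀ i l, 0 < A t i l → |x t l - x (t + 1) i| ≤ ε := by
  obtain ⟨hη, hA⟩ := hA
  set V : ℕ → ℝ := fun t => ∑ l, x t l ^ 2 with hV
  have hstep : ∀ t ≥ T, V (t + 1) + ∑ i, ∑ l, A t i l * (x t l - x (t + 1) i) ^ 2 = V t := by
    intro t ht
    simp only [hV, hx t ht]
    exact (hA t).1.sum_sq_mulVec_add (x t)
  have hnonneg : ∀ t i l, 0 ≤ A t i l * (x t l - x (t + 1) i) ^ 2 := fun t i l =>
    mul_nonneg ((hA t).1.1 i l) (sq_nonneg _)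
  have hanti : Antitone fun k => V (k + T) := antitone_nat_of_succ_le fun k => by
    have h₁ := hstep (k + T) (Nat.le_add_left _ _)
    have h₂ : 0 ≤ ∑ i, ∑ l, A (k + T) i l * (x (k + T) l - x (k + T + 1) i) ^ 2 :=
      Finset.sum_nonneg fun i _ => Finset.sum_nonneg fun l _ => hnonneg _ i l
    rw [show k + 1 + T = k + T + 1 by ring]
    linarith
  have hbdd : BddBelow (Set.range fun k => V (k + T)) :=
    ⟨0, by rintro _ ⟨k, rfl⟩; exact Finset.sum_nonneg fun l _ => sq_nonneg _⟩
  have hlim : Tendsto V atTop (nhds (⨅ k, V (k + T))) :=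
    (tendsto_add_atTop_iff_nat T).1 (tendsto_atTop_ciInf hanti hbdd)
  have hdiff : Tendsto (fun t => V t - V (t + 1)) atTop (nhds 0) := by
    simpa using hlim.sub ((tendsto_add_atTop_iff_nat 1).2 hlim)
  have hpos : 0 < η * ε ^ 2 := by positivity
  obtain ⟨N, hN⟩ := eventually_atTop.1 (hdiff.eventually (gt_mem_nhds hpos))
  refine ⟨max N T, le_max_right _ _, fun t ht i l hil => ?_⟩
  have h₁ := hN t ((le_max_left _ _).trans ht)
  have h₂ := hstep t ((le_max_right _ _).trans ht)
  have h₃ : A t i l * (x t l - x (t + 1) i) ^ 2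
      ≤ ∑ i, ∑ l, A t i l * (x t l - x (t + 1) i) ^ 2 :=
    (Finset.single_le_sum (f := fun l => A t i l * (x t l - x (t + 1) i) ^ 2)
      (fun l _ => hnonneg t i l) (Finset.mem_univ l)).trans
    (Finset.single_le_sum (f := fun i => ∑ l, A t i l * (x t l - x (t + 1) i) ^ 2)
      (fun i _ => Finset.sum_nonneg fun l _ => hnonneg t i l) (Finset.mem_univ i))
  have h₄ : η * (x t l - x (t + 1) i) ^ 2 ≤ A t i l * (x t l - x (t + 1) i) ^ 2 :=
    mul_le_mul_of_nonneg_right ((hA t).2.2 i l hil) (sq_nonneg _)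
  have h₅ : (x t l - x (t + 1) i) ^ 2 ≤ ε ^ 2 :=
    le_of_mul_le_mul_left (by linarith) hη
  exact abs_le_of_sq_le_sq h₅ hε.le

/-- The agents' values in the averaging iteration become asymptotically equal. -/
theorem tendsto_sub_of_averaging (hA : WeightsAssumption A η) (hB : ConnectivityAssumption A B)
    (hx : ∀ t ≥ T, x (t + 1) = (A t).mulVec (x t)) (i j : Fin n) :
    Tendsto (fun t => x t i - x t j) atTop (nhds 0) := by
  obtain ⟨L, hL⟩ := exists_abs_sub_le_of_reflTransGen (Fin n)
  obtain ⟨hB1, hconn⟩ := hB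
  rw [Metric.tendsto_atTop]
  intro δ hδ
  set C : ℝ := L * (2 * B + 1) + 2 * B with hC
  have hC0 : 0 ≤ C := by positivity
  set ε : ℝ := δ / (C + 1) with hεdef
  have hε : 0 < ε := by positivity
  have hCε : C * ε < δ := by
    have : (C + 1) * ε = δ := by rw [hεdef]; field_simp
    linarith
  obtain ⟨N, -, hN⟩ := hA.eventually_abs_sub_le hx hε
  have hdrift : ∀ s ≥ N, ∀ p : ℕ, p ≤ B → ∀ u, |x s u - x (s + p) u| ≤ B * ε := by
    intro s hs p hp u
    have h : |x s u - x (s + p) u| ≤ p * ε := by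
      clear hp
      induction p with
      | zero => simp
      | succ p ih =>
        have h₁ := hN (s + p) (by omega) u u ((hA.2 (s + p)).2.1 u)
        have h₂ := abs_sub_le (x s u) (x (s + p) u) (x (s + p + 1) u)
        push_cast
        rw [← add_assoc]
        linarith
    refine h.trans ?_
    have : (p : ℝ) ≤ B := by exact_mod_cast hp
    gcongr
  refine ⟨N + B, fun t ht => ?_⟩
  set k := t / B with hk
  have hdm : k * B + t % B = t := by rw [hk, mul_comm]; exact Nat.div_add_mod t B
  have hmod : t % B < B := Nat.mod_lt _ hB1
  have hkN : N ≤ k * B := by omega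
  have hblock : |x (k * B) i - x (k * B) j| ≤ L * ((2 * B + 1) * ε) := by
    refine hL _ i j (hconn k i j) (x (k * B)) _ (by positivity) ?_
    rintro u v ⟨q, hq₁, hq₂, hq⟩
    obtain ⟨p, rfl⟩ := Nat.exists_eq_add_of_le hq₁
    have hp : p + 1 ≤ B := by rw [add_mul] at hq₂; omega
    have h₁ := hdrift _ hkN p (by omega) u
    have h₂ := hN _ (hkN.trans hq₁) v u hq
    have h₃ := hdrift _ hkN (p + 1) hp v
    rw [← add_assoc] at h₃
    rw [abs_le] at *
    constructor <;> linarith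
  have hi := hdrift _ hkN (t % B) hmod.le i
  have hj := hdrift _ hkN (t % B) hmod.le j
  rw [hdm] at hi hj
  have : |x t i - x t j| ≤ C * ε := by
    rw [hC]
    rw [abs_le] at *
    constructor <;> linarith
  rw [Real.dist_eq, sub_zero]
  linarith

/-- The averaging iteration converges to the average of its initial values. -/
theorem tendsto_average_of_averaging (hA : WeightsAssumption A η)
    (hB : ConnectivityAssumption A B)
    (hx : ∀ t ≥ T, x (t + 1) = (A t).mulVec (x t)) (i : Fin n) :
    Tendsto (fun t => x t i) atTop (nhds ((∑ l, x T l) / n)) := by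
  have hn : (n : ℝ) ≠ 0 := by
    have := i.pos
    positivity
  have hsum : ∀ t ≥ T, ∑ l, x t l = ∑ l, x T l := by
    intro t ht
    induction t, ht using Nat.le_induction with
    | base => rfl
    | succ t ht ih => rw [hx t ht, (hA.2 t).1.sum_mulVec, ih]
  have h := (tendsto_finsetSum Finset.univ fun l _ =>
    tendsto_sub_of_averaging hA hB hx i l).div_const (n : ℝ) |>.add_const ((∑ l, x T l) / n)
  simp only [Finset.sum_const_zero, zero_div, zero_add] at h
  refine h.congr' ?_
  filter_upwards [eventually_ge_atTop T] with t ht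
  rw [Finset.sum_sub_distrib, hsum t ht, Finset.sum_const, Finset.card_univ, Fintype.card_fin,
    nsmul_eq_mul]
  field_simp
  ring

end Consensus

theorem Phi_self {n : ℕ} (A : ℕ → Matrix (Fin n) (Fin n) ℝ) (s : ℕ) : Phi A s s = A s := by
  simp [Phi]

theorem Phi_succ {n : ℕ} (A : ℕ → Matrix (Fin n) (Fin n) ℝ) {k s : ℕ} (h : s ≤ k + 1) :
    Phi A (k + 1) s = A (k + 1) * Phi A k s := by
  have : k + 1 + 1 - s = (k + 1 - s) + 1 := by omega
  simp [Phi, this, List.range_succ_eq_map, List.map_map, Function.comp_def]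

/-- The transition matrices converge entrywise to the uniform averaging matrix. -/
theorem tendsto_Phi {n : ℕ} {A : ℕ → Matrix (Fin n) (Fin n) ℝ} {η : ℝ} {B : ℕ}
    (hA : WeightsAssumption A η) (hB : ConnectivityAssumption A B) (s : ℕ) (i j : Fin n) :
    Tendsto (fun k => Phi A k s i j) atTop (nhds (1 / (n : ℝ))) := by
  have hx : ∀ t ≥ s + 1, (fun l => Phi A (t + 1 - 1) s l j)
      = (A t).mulVec (fun l => Phi A (t - 1) s l j) := by
    intro t ht
    obtain ⟨u, rfl⟩ : ∃ u, t = u + 1 := ⟨t - 1, by omega⟩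
    ext l
    simp only [Nat.add_sub_cancel]
    rw [Phi_succ A (by omega)]
    rfl
  have h := tendsto_average_of_averaging (x := fun t l => Phi A (t - 1) s l j) hA hB hx i
  simp only [Nat.add_sub_cancel, Phi_self, (hA.2 s).1.2.2 j] at h
  exact (tendsto_add_atTop_iff_nat 1).2 h

/-- for every stopping time `k̃` and every agent `i`, the stopped-model
sequence
`x̃_i(k) = Σ_j [Φ(k,0)]_{ij} x_jQ(0) − α Σ_{s=1}^{k̃} Σ_j [Φ(k,s)]_{ij} d̃_j(s−1)
  − Σ_{s=1}^{k̃} Σ_j [Φ(k,s)]_{ij} e_j(s)`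
converges as `k → ∞`, and its limit is independent of `i` and equals
`y(k̃) = (1/n) Σ_j x_jQ(0) − (α/n) Σ_{s=1}^{k̃} Σ_j d̃_j(s−1) − (1/n) Σ_{s=1}^{k̃} Σ_j e_j(s)`. -/
theorem stopped_model_converges
    (n m : ℕ) (hn : 1 ≤ n) (hm : 1 ≤ m)
    (A : ℕ → Matrix (Fin n) (Fin n) ℝ) (η : ℝ) (B : ℕ)
    (hA : WeightsAssumption A η) (hConn : ConnectivityAssumption A B)
    (f : Fin n → EuclideanSpace ℝ (Fin m) → ℝ)
    (hf : ∀ i, ConvexOn ℝ Set.univ (f i))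
    (Q : ℕ) (hQ : 0 < Q) (α : ℝ) (hα : 0 < α)
    (xQ d : ℕ → Fin n → EuclideanSpace ℝ (Fin m))
    (hd : ∀ k i, IsSubgradientAt (f i) (d k i) (xQ k i))
    (hq0 : ∀ (i : Fin n) (c : Fin m), ∃ z : ℤ, xQ 0 i c = (z : ℝ) / Q)
    (hup : ∀ (k : ℕ) (i : Fin n) (c : Fin m),
      xQ (k + 1) i c = ⌊(Q : ℝ) * ((∑ j, A k i j • xQ k j - α • d k i) c)⌋ / Q)
    (e : ℕ → Fin n → EuclideanSpace ℝ (Fin m))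
    (he : ∀ (k : ℕ) (i : Fin n),
      e (k + 1) i = ∑ j, A k i j • xQ k j - α • d k i - xQ (k + 1) i)
    :
    ∀ (ktil : ℕ) (i : Fin n),
      Filter.Tendsto
        (fun k : ℕ =>
          (∑ j, Phi A k 0 i j • xQ 0 j)
            - α • (∑ s ∈ Finset.Icc 1 ktil, ∑ j, Phi A k s i j • d (s - 1) j)
            - ∑ s ∈ Finset.Icc 1 ktil, ∑ j, Phi A k s i j • e s j)
        atTop
        (nhds ((1 / (n : ℝ)) • ∑ j, xQ 0 j
          - (α / (n : ℝ)) • ∑ s ∈ Finset.Icc 1 ktil, ∑ j, d (s - 1) j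
          - (1 / (n : ℝ)) • ∑ s ∈ Finset.Icc 1 ktil, ∑ j, e s j)) := by
  intro ktil i
  have hΦ : ∀ (s : ℕ) (w : Fin n → EuclideanSpace ℝ (Fin m)),
      Tendsto (fun k => ∑ j, Phi A k s i j • w j) atTop (nhds ((1 / (n : ℝ)) • ∑ j, w j)) := by
    intro s w
    rw [Finset.smul_sum]
    exact tendsto_finsetSum _ fun j _ => (tendsto_Phi hA hConn s i j).smul_const _
  have hsum : ∀ w : ℕ → Fin n → EuclideanSpace ℝ (Fin m),
      Tendsto (fun k => ∑ s ∈ Finset.Icc 1 ktil, ∑ j, Phi A k s i j • w s j) atTop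
        (nhds ((1 / (n : ℝ)) • ∑ s ∈ Finset.Icc 1 ktil, ∑ j, w s j)) := by
    intro w
    rw [Finset.smul_sum]
    exact tendsto_finsetSum _ fun s _ => hΦ s (w s)
  have h := ((hΦ 0 (xQ 0)).sub ((hsum fun s j => d (s - 1) j).const_smul α)).sub (hsum e)
  rwa [smul_smul, mul_one_div] at h
end
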